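/- arXiv:1207.6778 — 3 statements merged into one kernel-verified Lean document; each statement's English description precedes it below -/
import Mathlib

section
/- There is no 'bad configuration' with 6 points for the empty convex 5-gon game: for every set P of 6 points in general position containing no empty convex pentagon, there exists a point x such that P ∪ {x} is in general position and contains no empty convex pentagon. -/
open scoped Classical
noncomputable section

/-- Points in the plane. -/
abbrev Pt := ℝ × ℝ

/-- Signed area determinant of the triple (p, q, r). -/
def det (p q r : Pt) : ℝ := (q.1 - p.1) * (r.2 - p.2) - (q.2 - p.2) * (r.1 - p.1)

/-- A finite point set is in general position if no three distinct points are collinear. -/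
def GenPos (S : Finset Pt) : Prop :=
  ∀ p ∈ S, ∀ q ∈ S, ∀ r ∈ S, p ≠ q → p ≠ r → q ≠ r → ¬ Collinear ℝ ({p, q, r} : Set Pt)

/-- A finite point set is in convex position if no point lies in the
convex hull of the others. -/
def ConvexPos (S : Finset Pt) : Prop :=
  ∀ p ∈ S, p ∉ convexHull ℝ ((S.erase p : Finset Pt) : Set Pt)

/-- The vertices of the convex hull of a finite point set. -/
def hullVerts (S : Finset Pt) : Finset Pt :=
  S.filter (fun p => p ∉ convexHull ℝ ((S.erase p : Finset Pt) : Set Pt))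

/-- `S` is an empty convex pentagon of the point set `P`. -/
def EmptyConvexPentagon (P S : Finset Pt) : Prop :=
  S ⊆ P ∧ S.card = 5 ∧ ConvexPos S ∧
    ∀ p ∈ P, p ∉ S → p ∉ interior (convexHull ℝ (S : Set Pt))

/-- Type-1 beam `a : bc`: the convex cone with apex `a` spanned by the rays from `a`
through `b` and through `c`, minus the triangle `abc`. -/
def beam1 (a b c : Pt) : Set Pt :=
  {x | (∃ s t : ℝ, 0 ≤ s ∧ 0 ≤ t ∧ x = a + s • (b - a) + t • (c - a)) ∧
       x ∉ convexHull ℝ ({a, b, c} : Set Pt)}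

/-- Type-2 beam `pq : rs`: the convex region bounded by the segment `pq`, the ray
from `p` through `s` and the ray from `q` through `r`, minus the quadrilateral `pqrs`. -/
def beam2 (p q r s : Pt) : Set Pt :=
  {x | (∃ y ∈ segment ℝ p q, ∃ u v : ℝ, 0 ≤ u ∧ 0 ≤ v ∧ x = y + u • (s - p) + v • (r - q)) ∧
       x ∉ convexHull ℝ ({p, q, r, s} : Set Pt)}

/-- The O-region of triangle `abc` opposite the vertex `a`: points separated from `a`
by line `bc`, on the same side of line `ac` as `b`, and on the same side of line `ab` as `c`. -/
def ORegionOpp (a b c : Pt) : Set Pt :=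
  {x | det b c x * det b c a < 0 ∧ det a c x * det a c b > 0 ∧ det a b x * det a b c > 0}

/-- The I-region of triangle (or quadrilateral) at vertex `a` relative to the remaining
vertex set `R`: points `x` such that `a` lies strictly inside the convex hull of `{x} ∪ R`. -/
def IRegion (a : Pt) (R : Set Pt) : Set Pt :=
  {x | a ∈ interior (convexHull ℝ (insert x R))}

/-- A convex quadrilateral with vertices `a b c d` in this cyclic order. -/
def CyclicQuad (a b c d : Pt) : Prop :=
  ConvexPos ({a, b, c, d} : Finset Pt) ∧ ({a, b, c, d} : Finset Pt).card = 4 ∧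
    det a c b * det a c d < 0 ∧ det b d a * det b d c < 0

/-- The real number `r` is nonzero with the sign recorded by `b`. -/
def SignIs (r : ℝ) (b : Bool) : Prop := if b then 0 < r else r < 0

lemma SignIs.ne_zero {r : ℝ} {b : Bool} (h : SignIs r b) : r ≠ 0 := by
  cases b <;> simp [SignIs] at h
  · exact h.ne
  · exact h.ne'

lemma SignIs.pos_iff {r : ℝ} {b : Bool} (h : SignIs r b) : b = true ↔ 0 < r := by
  cases b <;> simp [SignIs] at h ⊢
  · exact h.le
  · exact h

lemma signIs_of_iff {r : ℝ} {b : Bool} (hr : r ≠ 0) (h : b = true ↔ 0 < r) : SignIs r b := by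
  cases b <;> simp [SignIs] at h ⊢
  · exact lt_of_le_of_ne h hr
  · exact h

lemma SignIs.neg {r : ℝ} {b : Bool} (h : SignIs r b) : SignIs (-r) (!b) := by
  cases b <;> simpa [SignIs] using h

lemma det_rotate (a b c : Pt) : det b c a = det a b c := by unfold det; ring

lemma det_swap (a b c : Pt) : det b a c = -det a b c := by unfold det; ring

lemma collinear_iff_det_eq_zero {a b : Pt} (hab : a ≠ b) (c : Pt) :
    Collinear ℝ ({a, b, c} : Set Pt) ↔ det a b c = 0 := by
  rw [collinear_iff_of_mem (p₀ := a) (by simp)]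
  constructor
  · rintro ⟨v, hv⟩
    obtain ⟨s, hs⟩ := hv b (by simp)
    obtain ⟨t, ht⟩ := hv c (by simp)
    subst hs ht
    simp [det]
    ring
  · intro h
    refine ⟨b - a, fun p hp => ?_⟩
    simp only [Set.mem_insert_iff, Set.mem_singleton_iff] at hp
    rcases hp with rfl | rfl | rfl
    · exact ⟨0, by simp⟩
    · exact ⟨1, by simp⟩
    · have hne : b.1 - a.1 ≠ 0 ∨ b.2 - a.2 ≠ 0 := by
        by_contra! hc
        exact hab (Prod.ext (by linarith [hc.1]) (by linarith [hc.2]))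
      unfold det at h
      rcases hne with h1 | h1
      · refine ⟨(p.1 - a.1) / (b.1 - a.1), Prod.ext ?_ ?_⟩
        · simp; field_simp; ring
        · simp; field_simp; linarith
      · refine ⟨(p.2 - a.2) / (b.2 - a.2), Prod.ext ?_ ?_⟩
        · simp; field_simp; linarith
        · simp; field_simp; ring

lemma GenPos.det_ne_zero {P : Finset Pt} (h : GenPos P) {a b c : Pt} (ha : a ∈ P) (hb : b ∈ P)
    (hc : c ∈ P) (hab : a ≠ b) (hac : a ≠ c) (hbc : b ≠ c) : det a b c ≠ 0 :=
  fun h0 => h a ha b hb c hc hab hac hbc ((collinear_iff_det_eq_zero hab c).2 h0)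

lemma mem_interior_convexHull_of_det_pos {a b c p : Pt} (h₁ : 0 < det a b p) (h₂ : 0 < det b c p)
    (h₃ : 0 < det c a p) : p ∈ interior (convexHull ℝ ({a, b, c} : Set Pt)) := by
  rw [mem_interior]
  refine ⟨{y | 0 < det a b y} ∩ {y | 0 < det b c y} ∩ {y | 0 < det c a y}, ?_, ?_,
    ⟨⟨h₁, h₂⟩, h₃⟩⟩
  · rintro y ⟨⟨k₁, k₂⟩, k₃⟩
    simp only [Set.mem_ofPred_eq] at k₁ k₂ k₃
    have hs : 0 < det a b y + det b c y + det c a y := by positivity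
    have hw : det b c y / (det a b y + det b c y + det c a y) +
        det c a y / (det a b y + det b c y + det c a y) +
        det a b y / (det a b y + det b c y + det c a y) = 1 := by
      field_simp; ring
    have hy : y = (det b c y / (det a b y + det b c y + det c a y)) • a +
        (det c a y / (det a b y + det b c y + det c a y)) • b +
        (det a b y / (det a b y + det b c y + det c a y)) • c := by
      ext
      · simp only [Prod.fst_add, Prod.smul_fst, smul_eq_mul]
        field_simp
        unfold det; ring
      · simp only [Prod.snd_add, Prod.smul_snd, smul_eq_mul]
        field_simp
        unfold det; ring
    rw [hy]
    have key := (convex_convexHull ℝ ({a, b, c} : Set Pt)).sum_mem (t := Finset.univ)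
      (w := ![det b c y / (det a b y + det b c y + det c a y),
      det c a y / (det a b y + det b c y + det c a y),
      det a b y / (det a b y + det b c y + det c a y)]) (z := ![a, b, c])
      (by intro i _; fin_cases i <;> simp <;> positivity)
      (by simpa [Fin.sum_univ_three] using hw)
      (by
        intro i _
        apply subset_convexHull
        fin_cases i <;> simp)
    simpa [Fin.sum_univ_three] using key
  · refine ((isOpen_lt continuous_const ?_).inter (isOpen_lt continuous_const ?_)).inter
      (isOpen_lt continuous_const ?_) <;> unfold det <;> fun_prop

lemma GenPos.exists_det_pos_of_mem_convexHull {P T : Finset Pt} (hP : GenPos P) (hT : T ⊆ P)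
    {p : Pt} (hp : p ∈ P) (hpT : p ∉ T) (h : p ∈ convexHull ℝ (T : Set Pt)) :
    ∃ a ∈ T, ∃ b ∈ T, ∃ c ∈ T, 0 < det a b p ∧ 0 < det b c p ∧ 0 < det c a p := by
  rw [convexHull_eq_union] at h
  simp only [Set.mem_iUnion] at h
  obtain ⟨t, htT, hind, hpt⟩ := h
  have hcard : t.card ≤ 3 := by
    have h := hind.card_le_finrank_succ.trans (Nat.add_le_add_right (Submodule.finrank_le _) 1)
    simpa using h
  rw [Finset.mem_convexHull'] at hpt
  obtain ⟨w, hw, hw1, hwp⟩ := hpt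
  have hne : ∀ a ∈ t, a ≠ p := fun a ha hap => hpT (hap ▸ htT ha)
  have htP : ∀ a ∈ t, a ∈ P := fun a ha => hT (htT ha)
  obtain hc | hc | hc | hc : t.card = 0 ∨ t.card = 1 ∨ t.card = 2 ∨ t.card = 3 := by omega
  · rw [Finset.card_eq_zero] at hc
    simp [hc] at hw1
  · obtain ⟨a, rfl⟩ := Finset.card_eq_one.1 hc
    simp at hw1 hwp hne
    simp [hw1] at hwp
    exact absurd hwp hne
  · obtain ⟨a, b, hab, rfl⟩ := Finset.card_eq_two.1 hc
    rw [Finset.sum_pair hab] at hw1 hwp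
    refine absurd ?_ (hP.det_ne_zero (htP a (by simp)) (htP b (by simp)) hp hab
      (hne a (by simp)) (hne b (by simp)))
    have hwb : w a = 1 - w b := by linarith
    rw [← hwp, hwb]
    simp [det]
    ring
  · obtain ⟨a, b, c, hab, hac, hbc, rfl⟩ := Finset.card_eq_three.1 hc
    have haT := htT (show a ∈ _ by simp)
    have hbT := htT (show b ∈ _ by simp)
    have hcT := htT (show c ∈ _ by simp)
    rw [Finset.sum_insert (by simp [hab, hac]), Finset.sum_pair hbc] at hw1 hwp
    have hwa : w a = 1 - w b - w c := by linarith
    have e1 : det a b p = w c * det a b c := by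
      rw [← hwp, hwa]; simp [det]; ring
    have e2 : det b c p = w a * det a b c := by
      rw [← hwp, hwa]; simp [det]; ring
    have e3 : det c a p = w b * det a b c := by
      rw [← hwp, hwa]; simp [det]; ring
    have n1 := hP.det_ne_zero (hT haT) (hT hbT) hp hab (hne a (by simp)) (hne b (by simp))
    have n2 := hP.det_ne_zero (hT hbT) (hT hcT) hp hbc (hne b (by simp)) (hne c (by simp))
    have n3 := hP.det_ne_zero (hT hcT) (hT haT) hp hac.symm (hne c (by simp)) (hne a (by simp))
    have p1 : 0 < w c := lt_of_le_of_ne (hw c (by simp)) fun h => n1 (by rw [e1, ← h, zero_mul])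
    have p2 : 0 < w a := lt_of_le_of_ne (hw a (by simp)) fun h => n2 (by rw [e2, ← h, zero_mul])
    have p3 : 0 < w b := lt_of_le_of_ne (hw b (by simp)) fun h => n3 (by rw [e3, ← h, zero_mul])
    rcases lt_or_gt_of_ne (hP.det_ne_zero (hT haT) (hT hbT) (hT hcT) hab hac hbc) with h | h
    · refine ⟨b, hbT, a, haT, c, hcT, ?_, ?_, ?_⟩
      · rw [det_swap, e1]; nlinarith
      · rw [det_swap, e3]; nlinarith
      · rw [det_swap, e2]; nlinarith
    · refine ⟨a, haT, b, hbT, c, hcT, ?_, ?_, ?_⟩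
      · rw [e1]; positivity
      · rw [e2]; positivity
      · rw [e3]; positivity

open Filter Topology in
lemma eventually_signIs {A B C : ℝ} {b : Bool}
    (h : SignIs A b ∨ A = 0 ∧ SignIs B b ∨ A = 0 ∧ B = 0 ∧ SignIs C b) :
    ∀ᶠ ε in 𝓝[>] (0 : ℝ), SignIs (A + ε * B + ε ^ 2 * C) b := by
  wlog hb : b = true generalizing A B C b
  · have := @this (-A) (-B) (-C) (!b) (by
      rcases h with h | ⟨h, k⟩ | ⟨h, k, l⟩
      · exact Or.inl h.neg
      · exact Or.inr (Or.inl ⟨by simp [h], k.neg⟩)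
      · exact Or.inr (Or.inr ⟨by simp [h], by simp [k], l.neg⟩)) (by simpa using hb)
    filter_upwards [this] with ε hε
    have := hε.neg
    rw [Bool.not_not] at this
    convert this using 1
    ring
  subst hb
  simp only [SignIs, if_true] at h ⊢
  have aux : ∀ A B C : ℝ, 0 < A → ∀ᶠ ε in 𝓝[>] (0 : ℝ), 0 < A + ε * B + ε ^ 2 * C := by
    intro A B C hA
    have hcont : Continuous fun ε : ℝ => A + ε * B + ε ^ 2 * C := by fun_prop
    have := hcont.continuousAt.eventually (lt_mem_nhds (a := 0) (b := A + 0 * B + 0 ^ 2 * C)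
      (by simpa using hA))
    exact this.filter_mono nhdsWithin_le_nhds
  rcases h with h | ⟨rfl, h⟩ | ⟨rfl, rfl, h⟩
  · exact aux A B C h
  · filter_upwards [aux B C 0 h, self_mem_nhdsWithin] with ε hε h0
    have h0 : 0 < ε := h0
    nlinarith [mul_pos h0 hε]
  · filter_upwards [self_mem_nhdsWithin] with ε h0
    have h0 : 0 < ε := h0
    simpa using by positivity

open Filter Topology in
/-- Points `T + ε d + ε² e` with `ε` small positive realize the signs that `T`, `d` and `e`
determine lexicographically. -/
lemma exists_near (n : ℕ) (f : ℕ → Pt) (T d e : Pt) (s : ℕ → ℕ → Bool)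
    (h : ∀ j < n, ∀ i < j, SignIs (det (f i) (f j) T) (s i j) ∨
      det (f i) (f j) T = 0 ∧ SignIs (det 0 (f j - f i) d) (s i j) ∨
      det (f i) (f j) T = 0 ∧ det 0 (f j - f i) d = 0 ∧ SignIs (det 0 (f j - f i) e) (s i j)) :
    ∃ x, ∀ j < n, ∀ i < j, SignIs (det (f i) (f j) x) (s i j) := by
  have key : ∀ᶠ ε in 𝓝[>] (0 : ℝ), ∀ j ∈ Finset.range n, ∀ i ∈ Finset.range j,
      SignIs (det (f i) (f j) (T + ε • d + ε ^ 2 • e)) (s i j) := by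
    refine (Finset.eventually_all _).2 fun j hj => (Finset.eventually_all _).2 fun i hi => ?_
    filter_upwards [eventually_signIs (h j (by simpa using hj) i (by simpa using hi))] with ε hε
    convert hε using 1
    simp [det]
    ring
  obtain ⟨ε, hε⟩ := key.exists
  exact ⟨_, fun j hj i hi => hε j (by simpa using hj) i (by simpa using hi)⟩

open Filter Topology in
/-- A point set in general position has a vertex from which the remaining points can be
listed in counterclockwise order. -/
lemma GenPos.exists_sorted {P : Finset Pt} (hP : GenPos P) {n : ℕ} (hn : P.card = n + 1) :
    ∃ f : ℕ → Pt, P = (Finset.range (n + 1)).image f ∧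
      ∀ k < n + 1, ∀ j < k, 0 < j → 0 < det (f 0) (f j) (f k) := by
  have hne : P.Nonempty := by rw [← Finset.card_pos]; omega
  obtain ⟨p, hp, hmin⟩ := P.exists_min_image (fun q => toLex q) hne
  have hev : ∀ᶠ ε in 𝓝[>] (0 : ℝ), ∀ q ∈ P.erase p, 0 < (q.1 - p.1) + ε * (q.2 - p.2) := by
    refine (Finset.eventually_all _).2 fun q hq => ?_
    have hlt : toLex p < toLex q := lt_of_le_of_ne (hmin q (Finset.mem_of_mem_erase hq))
      fun h => Finset.ne_of_mem_erase hq (toLex.injective h).symm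
    rw [Prod.Lex.toLex_lt_toLex] at hlt
    have := eventually_signIs (A := q.1 - p.1) (B := q.2 - p.2) (C := 0) (b := true) (by
      simp only [SignIs, if_true, sub_pos]
      rcases hlt with h | ⟨h, k⟩
      · exact Or.inl h
      · exact Or.inr (Or.inl ⟨by rw [h, sub_self], k⟩))
    filter_upwards [this] with ε hε
    simpa [SignIs] using hε
  obtain ⟨ε, hε⟩ := hev.exists
  set key : Pt → ℝ := fun q => (q.2 - p.2) / ((q.1 - p.1) + ε * (q.2 - p.2)) with hkey
  have hdet : ∀ q ∈ P.erase p, ∀ r ∈ P.erase p, key q < key r → 0 < det p q r := by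
    intro q hq r hr h
    rw [hkey] at h
    simp only at h
    rw [div_lt_div_iff₀ (hε q hq) (hε r hr)] at h
    unfold det
    nlinarith
  have hinj : Set.InjOn key (P.erase p : Finset Pt) := by
    intro q hq r hr h
    by_contra hqr
    rw [Finset.mem_coe] at hq hr
    refine hP.det_ne_zero hp (Finset.mem_of_mem_erase hq) (Finset.mem_of_mem_erase hr)
      (Finset.ne_of_mem_erase hq).symm (Finset.ne_of_mem_erase hr).symm hqr ?_
    rw [hkey] at h
    simp only at h
    rw [div_eq_div_iff (hε q hq).ne' (hε r hr).ne'] at h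
    unfold det
    linarith
  have hcard : ((P.erase p).image key).card = n := by
    rw [Finset.card_image_of_injOn hinj, Finset.card_erase_of_mem hp, hn, Nat.add_sub_cancel]
  set o := ((P.erase p).image key).orderEmbOfFin hcard with ho
  have hmem : ∀ i, ∃ q ∈ P.erase p, key q = o i := fun i =>
    Finset.mem_image.1 (Finset.orderEmbOfFin_mem _ hcard i)
  choose g hg hgo using hmem
  refine ⟨fun i => if h : i - 1 < n ∧ 0 < i then g ⟨i - 1, h.1⟩ else p, ?_, ?_⟩
  · symm
    apply Finset.eq_of_subset_of_card_le
    · intro q hq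
      obtain ⟨i, -, rfl⟩ := Finset.mem_image.1 hq
      split_ifs with h
      · exact Finset.mem_of_mem_erase (hg _)
      · exact hp
    · rw [hn, Finset.card_image_of_injOn, Finset.card_range]
      intro i hi j hj hij
      simp only [Finset.coe_range, Set.mem_Iio] at hi hj
      have hgp : ∀ i, g i ≠ p := fun i => Finset.ne_of_mem_erase (hg i)
      have hgi : Function.Injective g := fun i j h => o.injective (by rw [← hgo, ← hgo, h])
      dsimp only at hij
      split_ifs at hij with h1 h2 h2
      · have := congrArg Fin.val (hgi hij)
        simp only at this
        omega
      · exact absurd hij (hgp _)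
      · exact absurd hij.symm (hgp _)
      · omega
  · intro k hk j hj h0
    have hk' : k - 1 < n ∧ 0 < k := by omega
    have hj' : j - 1 < n ∧ 0 < j := by omega
    simp only [hk', hj', and_self, dif_pos, lt_irrefl, and_false, dif_neg, not_false_eq_true]
    refine hdet _ (hg _) _ (hg _) ?_
    rw [hgo, hgo]
    exact o.strictMono (by simp only [Fin.mk_lt_mk]; omega)

/-- The alternating extension of a sign table `t` given on increasing triples. -/
def altExtend (t : ℕ → ℕ → ℕ → Bool) (i j k : ℕ) : Bool :=
  bif i.blt j then
    bif j.blt k then t i j k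
    else bif i.blt k then k.blt j && !t i k j
    else k.blt i && t k i j
  else bif j.blt i then
    bif i.blt k then !t j i k
    else bif j.blt k then k.blt i && t j k i
    else k.blt j && !t k j i
  else false

/-- Some point of index below `n` lies inside a positively oriented triangle whose vertices have
indices below `n` other than `i` and `j`. -/
def isBlocked (n : ℕ) (χ : ℕ → ℕ → ℕ → Bool) (i j : ℕ) : Bool :=
  let l := (List.range n).filter fun a => !(a.beq i || a.beq j)
  l.any fun a => l.any fun b => a.blt b && l.any fun c => a.blt c && (χ a b c &&
    (List.range n).any fun p => χ a b p && (χ b c p && χ c a p))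

/-- Sign consistency with the three-term Grassmann–Plücker relation. -/
def pluckerOK (χ : ℕ → ℕ → ℕ → Bool) (a b u v w : ℕ) : Bool :=
  !(((χ a b u == χ a v w) != (χ a b v == χ a u w)) &&
    ((χ a b u == χ a v w) == (χ a b w == χ a u v)))

/-- Sign table of six points of which `1, …, 5` are in counterclockwise order around `0`. -/
def fanTable (b₀ b₁ b₂ b₃ b₄ b₅ b₆ b₇ b₈ b₉ : Bool) (i j k : ℕ) : Bool :=
  match i, j, k with
  | 1, 2, 3 => b₀ | 1, 2, 4 => b₁ | 1, 2, 5 => b₂ | 1, 3, 4 => b₃ | 1, 3, 5 => b₄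
  | 1, 4, 5 => b₅ | 2, 3, 4 => b₆ | 2, 3, 5 => b₇ | 2, 4, 5 => b₈ | 3, 4, 5 => b₉
  | _, _, _ => true

/-- Sign table obtained by adding a point `6` next to `p`, in the direction of `r` up to a small
deviation to the side `s`. -/
def doubleTable (χ : ℕ → ℕ → ℕ → Bool) (p r : ℕ) (s : Bool) (i j k : ℕ) : Bool :=
  bif k.beq 6 then
    bif i.beq p then bif j.beq r then s else χ p j r
    else bif j.beq p then bif i.beq r then !s else !χ p i r
    else χ i j p
  else χ i j k

/-- Sign table of a convex pentagon `0, …, 4` with the point `5` in the inner pentagon cut out by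
its diagonals. -/
def pentagonTable (i j k : ℕ) : Bool :=
  bif k.beq 5 then (j - i).ble 2 else true

/-- Sign table obtained from `pentagonTable` by adding a point `6` just beyond the intersection
of the lines `40` and `12`. -/
def tipTable (s : Bool) (i j k : ℕ) : Bool :=
  bif k.beq 6 then
    match i, j with
    | 0, 1 | 0, 2 | 0, 3 | 0, 5 | 1, 2 | 4, 5 => false
    | 3, 5 => s
    | _, _ => true
  else pentagonTable i j k

/-- No pentagon among the seven points is convex and empty. -/
def noHoles (χ : ℕ → ℕ → ℕ → Bool) : Bool :=
  (List.range 7).all fun i => (List.range i).all fun j => isBlocked 7 χ i j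

lemma natBeq_eq_decide (i j : ℕ) : i.beq j = decide (i = j) := by
  rw [Bool.eq_iff_iff, Nat.beq_eq, decide_eq_true_iff]

lemma isBlocked_iff {n : ℕ} {χ : ℕ → ℕ → ℕ → Bool} {i j : ℕ} :
    isBlocked n χ i j = true ↔ ∃ a < n, (a ≠ i ∧ a ≠ j) ∧ ∃ b < n, (b ≠ i ∧ b ≠ j) ∧ a < b ∧
      ∃ c < n, (c ≠ i ∧ c ≠ j) ∧ a < c ∧ χ a b c = true ∧
        ∃ p < n, χ a b p = true ∧ χ b c p = true ∧ χ c a p = true := by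
  simp [isBlocked, natBeq_eq_decide, and_assoc]

lemma noHoles_tipTable (s : Bool) : noHoles (altExtend (tipTable s)) = true := by
  revert s
  decide +kernel

set_option maxRecDepth 10000 in
lemma fanTable_cases : ∀ b₀ b₁ b₂ b₃ b₄ b₅ b₆ b₇ b₈ b₉ : Bool,
    (let χ := altExtend (fanTable b₀ b₁ b₂ b₃ b₄ b₅ b₆ b₇ b₈ b₉)
    !pluckerOK χ 1 3 0 2 4 || !pluckerOK χ 3 4 0 1 2 || !pluckerOK χ 1 5 2 3 4 ||
    !pluckerOK χ 2 3 0 4 5 || !pluckerOK χ 4 5 0 2 3 || !pluckerOK χ 1 4 0 2 5 ||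
    !pluckerOK χ 4 5 0 1 2 || !pluckerOK χ 3 4 1 2 5 ||
    !((List.range 6).all fun i => isBlocked 6 χ i i) ||
    [b₀, b₁, b₂, b₃, b₄, b₅, b₆, b₇, b₈, b₉] ==
      [true, true, true, false, true, true, false, false, true, true] ||
    noHoles (altExtend (doubleTable χ 0 2 true)) ||
    noHoles (altExtend (doubleTable χ 2 0 false)) ||
    noHoles (altExtend (doubleTable χ 2 4 true))) = true := by
  decide +kernel

/-- The first `n` points of `f` are oriented as prescribed by `t` on increasing triples. -/
def Realizes (n : ℕ) (f : ℕ → Pt) (t : ℕ → ℕ → ℕ → Bool) : Prop :=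
  ∀ k < n, ∀ j < k, ∀ i < j, SignIs (det (f i) (f j) (f k)) (t i j k)

lemma Realizes.altExtend_iff {n : ℕ} {f : ℕ → Pt} {t : ℕ → ℕ → ℕ → Bool} (h : Realizes n f t)
    {i j k : ℕ} (hi : i < n) (hj : j < n) (hk : k < n) :
    altExtend t i j k = true ↔ 0 < det (f i) (f j) (f k) := by
  have e1 : det (f i) (f j) (f k) = det (f j) (f k) (f i) := by unfold det; ring
  have e2 : det (f i) (f j) (f k) = det (f k) (f i) (f j) := by unfold det; ring
  have e3 : det (f i) (f j) (f k) = -det (f j) (f i) (f k) := by unfold det; ring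
  have e4 : det (f i) (f j) (f k) = -det (f i) (f k) (f j) := by unfold det; ring
  have e5 : det (f i) (f j) (f k) = -det (f k) (f j) (f i) := by unfold det; ring
  rcases lt_trichotomy i j with hij | rfl | hij
  · rcases lt_trichotomy j k with hjk | rfl | hjk
    · simpa [altExtend, hij, hjk] using (h k hk j hjk i hij).pos_iff
    · simp [altExtend, hij, det, mul_comm]
    · rcases lt_trichotomy i k with hik | rfl | hik
      · rw [e4]
        simpa [altExtend, hij, hjk, hik, hjk.not_gt] using (h j hj k hjk i hik).neg.pos_iff
      · simp [altExtend, hij, hjk.not_gt, det]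
      · rw [e2]
        simpa [altExtend, hij, hjk, hik, hik.not_gt, hjk.not_gt] using
          (h j hj i hij k hik).pos_iff
  · simp [altExtend, det]
  · rcases lt_trichotomy i k with hik | rfl | hik
    · rw [e3]
      simpa [altExtend, hij, hik, hij.not_gt] using (h k hk i hik j hij).neg.pos_iff
    · simp [altExtend, hij, hij.not_gt, det]
    · rcases lt_trichotomy j k with hjk | rfl | hjk
      · rw [e1]
        simpa [altExtend, hij, hjk, hik, hij.not_gt, hik.not_gt] using
          (h i hi k hik j hjk).pos_iff
      · simp [altExtend, hij, hij.not_gt, det, mul_comm]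
      · rw [e5]
        simpa [altExtend, hij, hjk, hik, hij.not_gt, hik.not_gt, hjk.not_gt] using
          (h i hi j hij k hjk).neg.pos_iff

lemma Realizes.det_ne_zero {n : ℕ} {f : ℕ → Pt} {t : ℕ → ℕ → ℕ → Bool} (h : Realizes n f t)
    {i j k : ℕ} (hi : i < n) (hj : j < n) (hk : k < n) (hij : i ≠ j) (hik : i ≠ k)
    (hjk : j ≠ k) : det (f i) (f j) (f k) ≠ 0 := by
  wlog hlt : i < j generalizing i j
  · rw [det_swap, neg_ne_zero]
    exact this hj hi hij.symm hjk hik (by omega)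
  rcases lt_or_gt_of_ne hjk with h1 | h1
  · exact (h k hk j h1 i hlt).ne_zero
  rcases lt_or_gt_of_ne hik with h2 | h2
  · rw [show det (f i) (f j) (f k) = -det (f i) (f k) (f j) by unfold det; ring, neg_ne_zero]
    exact (h j hj k h1 i h2).ne_zero
  · rw [← det_rotate, ← det_rotate]
    exact (h j hj i hlt k h2).ne_zero

lemma Realizes.signIs {n : ℕ} {f : ℕ → Pt} {t : ℕ → ℕ → ℕ → Bool} (h : Realizes n f t)
    {i j k : ℕ} (hi : i < n) (hj : j < n) (hk : k < n) (hij : i ≠ j) (hik : i ≠ k)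
    (hjk : j ≠ k) : SignIs (det (f i) (f j) (f k)) (altExtend t i j k) :=
  signIs_of_iff (h.det_ne_zero hi hj hk hij hik hjk) (h.altExtend_iff hi hj hk)

lemma Realizes.injOn {n : ℕ} {f : ℕ → Pt} {t : ℕ → ℕ → ℕ → Bool} (h : Realizes n f t)
    (hn : 3 ≤ n) : Set.InjOn f (Finset.range n) := by
  intro i hi j hj hij
  simp only [Finset.coe_range, Set.mem_Iio] at hi hj
  by_contra hne
  obtain ⟨k, hk, hki, hkj⟩ : ∃ k < n, k ≠ i ∧ k ≠ j := by
    by_contra! hc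
    have := hc 0 (by omega)
    have := hc 1 (by omega)
    have := hc 2 (by omega)
    omega
  refine h.det_ne_zero hi hj hk hne hki.symm hkj.symm ?_
  rw [hij]
  simp [det]

lemma Realizes.genPos {n : ℕ} {f : ℕ → Pt} {t : ℕ → ℕ → ℕ → Bool} (h : Realizes n f t) :
    GenPos ((Finset.range n).image f) := by
  intro p hp q hq r hr hpq hpr hqr
  obtain ⟨i, hi, rfl⟩ := Finset.mem_image.1 hp
  obtain ⟨j, hj, rfl⟩ := Finset.mem_image.1 hq
  obtain ⟨k, hk, rfl⟩ := Finset.mem_image.1 hr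
  rw [Finset.mem_range] at hi hj hk
  rw [collinear_iff_det_eq_zero hpq]
  exact h.det_ne_zero hi hj hk (by grind) (by grind) (by grind)

lemma Realizes.plucker {n : ℕ} {f : ℕ → Pt} {t : ℕ → ℕ → ℕ → Bool} (h : Realizes n f t)
    {a b u v w : ℕ} (hlt : a < n ∧ b < n ∧ u < n ∧ v < n ∧ w < n)
    (hne : [a, b, u, v, w].Nodup) : pluckerOK (altExtend t) a b u v w = true := by
  obtain ⟨ha, hb, hu, hv, hw⟩ := hlt
  simp only [List.nodup_cons, List.mem_cons, List.not_mem_nil, or_false, not_or, not_false_eq_true,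
    List.nodup_nil, and_true] at hne
  obtain ⟨⟨hab, hau, hav, haw⟩, ⟨hbu, hbv, hbw⟩, ⟨huv, huw⟩, hvw⟩ := hne
  have key : ∀ {x y : ℝ} {c d : Bool}, SignIs x c → SignIs y d → SignIs (x * y) (c == d) := by
    intro x y c d hx hy
    cases c <;> cases d <;> simp [SignIs] at hx hy ⊢ <;> nlinarith
  have h1 := key (h.signIs ha hb hu hab hau hbu) (h.signIs ha hv hw hav haw hvw)
  have h2 := key (h.signIs ha hb hv hab hav hbv) (h.signIs ha hu hw hau haw huw)
  have h3 := key (h.signIs ha hb hw hab haw hbw) (h.signIs ha hu hv hau hav huv)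
  have hgp : det (f a) (f b) (f u) * det (f a) (f v) (f w) -
      det (f a) (f b) (f v) * det (f a) (f u) (f w) +
      det (f a) (f b) (f w) * det (f a) (f u) (f v) = 0 := by
    unfold det; ring
  unfold pluckerOK
  generalize (altExtend t a b u == altExtend t a v w) = x at *
  generalize (altExtend t a b v == altExtend t a u w) = y at *
  generalize (altExtend t a b w == altExtend t a u v) = z at *
  cases x <;> cases y <;> cases z <;> simp [SignIs] at h1 h2 h3 ⊢ <;> linarith

lemma Realizes.comp {n : ℕ} {f : ℕ → Pt} {t t' : ℕ → ℕ → ℕ → Bool} (h : Realizes n f t)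
    (σ : ℕ → ℕ) (hσ : ∀ i < n, σ i < n) (hinj : ∀ j < n, ∀ i < j, σ i ≠ σ j)
    (ht : ∀ k < n, ∀ j < k, ∀ i < j, altExtend t (σ i) (σ j) (σ k) = t' i j k) :
    Realizes n (f ∘ σ) t' := by
  intro k hk j hj i hi
  rw [← ht k hk j hj i hi]
  exact h.signIs (hσ i (by omega)) (hσ j (by omega)) (hσ k hk) (hinj j (by omega) i hi)
    (hinj k hk i (by omega)) (hinj k hk j hj)

lemma Realizes.update {n : ℕ} {f : ℕ → Pt} {t t' : ℕ → ℕ → ℕ → Bool} (h : Realizes n f t)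
    {x : Pt} (hx : ∀ j < n, ∀ i < j, SignIs (det (f i) (f j) x) (t' i j n))
    (ht : ∀ k < n, ∀ j < k, ∀ i < j, t' i j k = t i j k) :
    Realizes (n + 1) (Function.update f n x) t' := by
  intro k hk j hj i hi
  rcases Nat.lt_succ_iff_lt_or_eq.1 hk with hk | rfl
  · rw [ht k hk j hj i hi, Function.update_of_ne (by omega), Function.update_of_ne (by omega),
      Function.update_of_ne (by omega)]
    exact h k hk j hj i hi
  · rw [Function.update_self, Function.update_of_ne (by omega), Function.update_of_ne (by omega)]
    exact hx j hj i hi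

lemma Realizes.isBlocked_of_no_hole {n : ℕ} {f : ℕ → Pt} {t : ℕ → ℕ → ℕ → Bool} (h : Realizes n f t)
    (hn : n = 6) (hno : ¬∃ S, EmptyConvexPentagon ((Finset.range n).image f) S) {i : ℕ}
    (hi : i < n) : isBlocked n (altExtend t) i i = true := by
  by_contra hb
  refine hno ⟨((Finset.range n).image f).erase (f i), Finset.erase_subset _ _, ?_, ?_⟩
  · rw [Finset.card_erase_of_mem (Finset.mem_image_of_mem f (Finset.mem_range.2 hi)),
      Finset.card_image_of_injOn (h.injOn (by omega)), Finset.card_range, hn]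
  have key : ∀ p ∈ (Finset.range n).image f, p ∉ convexHull ℝ
      (((((Finset.range n).image f).erase (f i)).erase p : Finset Pt) : Set Pt) := by
    intro p hp hmem
    obtain ⟨a', ha', b', hb', c', hc', h1, h2, h3⟩ := h.genPos.exists_det_pos_of_mem_convexHull
      ((Finset.erase_subset _ _).trans (Finset.erase_subset _ _)) hp (by simp) hmem
    have hidx : ∀ q ∈ (((Finset.range n).image f).erase (f i)).erase p,
        ∃ a < n, a ≠ i ∧ f a = q := by
      intro q hq
      obtain ⟨a, ha, rfl⟩ := Finset.mem_image.1
        (Finset.mem_of_mem_erase (Finset.mem_of_mem_erase hq))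
      exact ⟨a, by simpa using ha, fun hai =>
        Finset.ne_of_mem_erase (Finset.mem_of_mem_erase hq) (by rw [hai]), rfl⟩
    obtain ⟨a, ha, hai, rfl⟩ := hidx a' ha'
    obtain ⟨b, hbn, hbi, rfl⟩ := hidx b' hb'
    obtain ⟨c, hcn, hci, rfl⟩ := hidx c' hc'
    obtain ⟨m, hm, rfl⟩ := Finset.mem_image.1 hp
    rw [Finset.mem_range] at hm
    have h4 : 0 < det (f a) (f b) (f c) := by
      have : det (f a) (f b) (f c) =
          det (f a) (f b) (f m) + det (f b) (f c) (f m) + det (f c) (f a) (f m) := by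
        unfold det; ring
      linarith
    have hab : a ≠ b := by rintro rfl; simp [det] at h4
    have hac : a ≠ c := by rintro rfl; simp [det] at h4
    have hbc : b ≠ c := by rintro rfl; simp [det, mul_comm] at h4
    have aux : ∀ {a b c : ℕ}, a < n → b < n → c < n → a ≠ i → b ≠ i → c ≠ i → a < b → a < c →
        0 < det (f a) (f b) (f c) → 0 < det (f a) (f b) (f m) → 0 < det (f b) (f c) (f m) →
        0 < det (f c) (f a) (f m) → False := by
      intro a b c ha hb' hc hai hbi hci hab hac h4 h1 h2 h3
      exact hb (isBlocked_iff.2 ⟨a, ha, ⟨hai, hai⟩, b, hb', ⟨hbi, hbi⟩, hab, c, hc, ⟨hci, hci⟩,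
        hac, (h.altExtend_iff ha hb' hc).2 h4, m, hm, (h.altExtend_iff ha hb' hm).2 h1,
        (h.altExtend_iff hb' hc hm).2 h2, (h.altExtend_iff hc ha hm).2 h3⟩)
    rcases lt_or_gt_of_ne hab with hab | hab <;> rcases lt_or_gt_of_ne hac with hac | hac <;>
      rcases lt_or_gt_of_ne hbc with hbc | hbc
    all_goals first
      | omega
      | exact aux ha hbn hcn hai hbi hci (by assumption) (by assumption) h4 h1 h2 h3
      | exact aux hbn hcn ha hbi hci hai (by assumption) (by assumption)
          (by rwa [det_rotate]) h2 h3 h1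
      | exact aux hcn ha hbn hci hai hbi (by assumption) (by assumption)
          (by rwa [← det_rotate]) h3 h1 h2
  refine ⟨fun p hp => key p (Finset.mem_of_mem_erase hp), fun p hp hpS hpint => key p hp ?_⟩
  rw [Finset.erase_eq_of_notMem hpS]
  exact interior_subset hpint

lemma Realizes.not_emptyConvexPentagon {f : ℕ → Pt} {t : ℕ → ℕ → ℕ → Bool}
    (h : Realizes 7 f t) (hno : noHoles (altExtend t) = true) :
    ¬∃ S, EmptyConvexPentagon ((Finset.range 7).image f) S := by
  rintro ⟨S, hS, hcard, hconv, hempty⟩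
  set I := (Finset.range 7).filter fun i => f i ∈ S with hI
  have hSI : I.image f = S := by
    ext p
    constructor
    · intro hp
      obtain ⟨i, hi, rfl⟩ := Finset.mem_image.1 hp
      exact (Finset.mem_filter.1 hi).2
    · intro hp
      obtain ⟨i, hi, rfl⟩ := Finset.mem_image.1 (hS hp)
      exact Finset.mem_image_of_mem f (Finset.mem_filter.2 ⟨hi, hp⟩)
  have hIcard : I.card = 5 := by
    rw [← hcard, ← hSI, Finset.card_image_of_injOn]
    exact (h.injOn (by norm_num)).mono (Finset.coe_subset.2 (Finset.filter_subset _ _))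
  obtain ⟨u, v, huv, hsd⟩ := Finset.card_eq_two.1 (show (Finset.range 7 \ I).card = 2 by
    rw [Finset.card_sdiff_of_subset (Finset.filter_subset _ _), hIcard, Finset.card_range])
  have hmem : ∀ a < 7, a ≠ u ∧ a ≠ v → f a ∈ S := by
    intro a ha hne
    by_contra haS
    have : a ∈ Finset.range 7 \ I := by simp [hI, ha, haS]
    rw [hsd] at this
    simp [hne.1, hne.2] at this
  have hu : u < 7 := by
    have : u ∈ Finset.range 7 \ I := by simp [hsd]
    simpa using (Finset.mem_sdiff.1 this).1
  have hv : v < 7 := by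
    have : v ∈ Finset.range 7 \ I := by simp [hsd]
    simpa using (Finset.mem_sdiff.1 this).1
  have hblk : ∃ a < 7, f a ∈ S ∧ ∃ b < 7, f b ∈ S ∧ ∃ c < 7, f c ∈ S ∧ ∃ p < 7,
      altExtend t a b p = true ∧ altExtend t b c p = true ∧ altExtend t c a p = true := by
    have : isBlocked 7 (altExtend t) u v = true ∨ isBlocked 7 (altExtend t) v u = true := by
      simp only [noHoles, List.all_eq_true, List.mem_range] at hno
      rcases lt_or_gt_of_ne huv with h | h
      · exact Or.inr (hno v hv u h)
      · exact Or.inl (hno u hu v h)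
    rcases this with hb | hb <;> rw [isBlocked_iff] at hb <;>
      obtain ⟨a, ha, hau, b, hb, hbu, -, c, hc, hcu, -, -, p, hp, h1⟩ := hb
    · exact ⟨a, ha, hmem a ha hau, b, hb, hmem b hb hbu, c, hc, hmem c hc hcu, p, hp, h1⟩
    · exact ⟨a, ha, hmem a ha hau.symm, b, hb, hmem b hb hbu.symm, c, hc, hmem c hc hcu.symm,
        p, hp, h1⟩
  obtain ⟨a, ha, haS, b, hb, hbS, c, hc, hcS, p, hp, h1, h2, h3⟩ := hblk
  rw [h.altExtend_iff ha hb hp] at h1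
  rw [h.altExtend_iff hb hc hp] at h2
  rw [h.altExtend_iff hc ha hp] at h3
  have hpint := mem_interior_convexHull_of_det_pos h1 h2 h3
  by_cases hpS : f p ∈ S
  · refine hconv _ hpS (convexHull_mono ?_ (interior_subset hpint))
    have hpa : f a ≠ f p := by intro h; simp [h, det] at h1
    have hpb : f b ≠ f p := by intro h; simp [h, det] at h2
    have hpc : f c ≠ f p := by intro h; simp [h, det] at h3
    simp [Set.insert_subset_iff, haS, hbS, hcS, hpa, hpb, hpc]
  · refine hempty _ (Finset.mem_image_of_mem f (by simpa using hp)) hpS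
      (interior_mono (convexHull_mono ?_) hpint)
    simp [Set.insert_subset_iff, haS, hbS, hcS]

lemma Realizes.exists_extension {f : ℕ → Pt} {t t' : ℕ → ℕ → ℕ → Bool} (h : Realizes 6 f t)
    (hx : ∃ x, ∀ j < 6, ∀ i < j, SignIs (det (f i) (f j) x) (t' i j 6))
    (ht : ∀ k < 6, ∀ j < k, ∀ i < j, t' i j k = t i j k)
    (hno : noHoles (altExtend t') = true) :
    ∃ x, x ∉ (Finset.range 6).image f ∧ GenPos (insert x ((Finset.range 6).image f)) ∧
      ¬∃ S, EmptyConvexPentagon (insert x ((Finset.range 6).image f)) S := by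
  obtain ⟨x, hx⟩ := hx
  have h7 : Realizes 7 (Function.update f 6 x) t' := h.update hx ht
  have himg : insert x ((Finset.range 6).image f) =
      (Finset.range 7).image (Function.update f 6 x) := by
    rw [Finset.range_add_one (n := 6), Finset.image_insert, Function.update_self]
    congr 1
  refine ⟨x, fun hmem => ?_, himg ▸ h7.genPos, himg ▸ h7.not_emptyConvexPentagon hno⟩
  obtain ⟨i, hi, hix⟩ := Finset.mem_image.1 hmem
  rw [Finset.mem_range] at hi
  refine hi.ne (h7.injOn (by norm_num) (by simp; omega) (by simp) ?_)
  rw [Function.update_self, Function.update_of_ne hi.ne, hix]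

lemma Realizes.exists_double {f : ℕ → Pt} {t : ℕ → ℕ → ℕ → Bool} (h : Realizes 6 f t)
    {p r : ℕ} (hp : p < 6) (hr : r < 6) (hpr : p ≠ r) (s : Bool)
    (hno : noHoles (altExtend (doubleTable (altExtend t) p r s)) = true) :
    ∃ x, x ∉ (Finset.range 6).image f ∧ GenPos (insert x ((Finset.range 6).image f)) ∧
      ¬∃ S, EmptyConvexPentagon (insert x ((Finset.range 6).image f)) S := by
  refine h.exists_extension ?_ ?_ hno
  · have hne : f p ≠ f r := fun he => hpr (h.injOn (by norm_num) (by simpa) (by simpa) he)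
    have hpos : 0 < ((f r).1 - (f p).1) ^ 2 + ((f r).2 - (f p).2) ^ 2 := by
      by_contra! hle
      exact hne (Prod.ext
        (by nlinarith [sq_nonneg ((f r).1 - (f p).1), sq_nonneg ((f r).2 - (f p).2)])
        (by nlinarith [sq_nonneg ((f r).1 - (f p).1), sq_nonneg ((f r).2 - (f p).2)]))
    refine exists_near 6 f (f p) (f r - f p)
      ((if s then 1 else -1 : ℝ) • (-((f r).2 - (f p).2), (f r).1 - (f p).1)) _ ?_
    intro j hj i hi
    have hside : SignIs (det 0 (f r - f p)
        ((if s then 1 else -1 : ℝ) • (-((f r).2 - (f p).2), (f r).1 - (f p).1))) s := by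
      cases s <;> simp [SignIs, det] <;> nlinarith
    by_cases hip : i = p
    · subst hip
      by_cases hjr : j = r
      · subst hjr
        refine Or.inr (Or.inr ⟨by simp [det], by simp [det, mul_comm], ?_⟩)
        simpa [doubleTable, natBeq_eq_decide] using hside
      · refine Or.inr (Or.inl ⟨by simp [det], ?_⟩)
        convert h.signIs hp hj hr hi.ne hpr hjr using 1
        · simp [det]
        · simp [doubleTable, natBeq_eq_decide, hjr]
    · by_cases hjp : j = p
      · subst hjp
        by_cases hir : i = r
        · subst hir
          refine Or.inr (Or.inr ⟨by simp [det, mul_comm], by simp [det]; ring, ?_⟩)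
          convert hside.neg using 1
          · simp [det]; ring
          · simp [doubleTable, natBeq_eq_decide, hip]
        · refine Or.inr (Or.inl ⟨by simp [det, mul_comm], ?_⟩)
          convert (h.signIs hp (by omega) hr hi.ne' hpr hir).neg using 1
          · simp [det]; ring
          · simp [doubleTable, natBeq_eq_decide, hip, hir]
      · left
        convert h.signIs (by omega) hj hp hi.ne hip hjp using 1
        simp [doubleTable, natBeq_eq_decide, hip, hjp]
  · intro k hk j hj i hi
    have : doubleTable (altExtend t) p r s i j k = altExtend t i j k := by
      simp [doubleTable, natBeq_eq_decide, hk.ne]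
    have hi' : i.blt j = true := by simpa using hi
    have hj' : j.blt k = true := by simpa using hj
    rw [this, altExtend, hi', hj', cond_true, cond_true]

lemma det_extend_left (a b c : Pt) (t : ℝ) : det a b (c + t • (c - a)) = (1 + t) * det a b c := by
  simp [det]; ring

lemma det_extend_right (a b c : Pt) (t : ℝ) : det a b (c + t • (c - b)) = (1 + t) * det a b c := by
  simp [det]; ring

lemma det_reflect (a b c : Pt) (t : ℝ) : det a b (a + t • (a - c)) = t * det a c b := by
  simp [det]; ring

lemma exists_signIs {A B C : ℝ} (h : ¬(A = 0 ∧ B = 0 ∧ C = 0)) :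
    ∃ s, SignIs A s ∨ A = 0 ∧ SignIs B s ∨ A = 0 ∧ B = 0 ∧ SignIs C s := by
  have key : ∀ {r : ℝ}, r ≠ 0 → SignIs r (decide (0 < r)) := fun hr =>
    signIs_of_iff hr decide_eq_true_iff
  by_cases hA : A = 0
  · by_cases hB : B = 0
    · exact ⟨_, Or.inr (Or.inr ⟨hA, hB, key fun hC => h ⟨hA, hB, hC⟩⟩)⟩
    · exact ⟨_, Or.inr (Or.inl ⟨hA, key hB⟩)⟩
  · exact ⟨_, Or.inl (key hA)⟩

lemma Realizes.exists_tip {f : ℕ → Pt} (h : Realizes 6 f pentagonTable)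
    (hK : 0 < det 0 (f 0 - f 4) (f 2 - f 1)) :
    ∃ x, x ∉ (Finset.range 6).image f ∧ GenPos (insert x ((Finset.range 6).image f)) ∧
      ¬∃ S, EmptyConvexPentagon (insert x ((Finset.range 6).image f)) S := by
  have pos : ∀ i j k, (i < 6 ∧ j < 6 ∧ k < 6) ∧ altExtend pentagonTable i j k = true →
      0 < det (f i) (f j) (f k) := fun i j k hc =>
    (h.altExtend_iff hc.1.1 hc.1.2.1 hc.1.2.2).1 hc.2
  have sgn : ∀ {r : ℝ}, 0 < r → SignIs r true := fun hr => by simpa [SignIs] using hr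
  have sgn' : ∀ {r : ℝ}, 0 < r → SignIs (-r) false := fun hr => by simpa [SignIs] using hr
  obtain ⟨t, u, ht, hu, hT⟩ : ∃ t u : ℝ, 0 < t ∧ 0 < u ∧
      f 0 + t • (f 0 - f 4) = f 1 + u • (f 1 - f 2) := by
    refine ⟨det (f 0) (f 1) (f 2) / det 0 (f 0 - f 4) (f 2 - f 1),
      det (f 4) (f 0) (f 1) / det 0 (f 0 - f 4) (f 2 - f 1), div_pos (pos _ _ _ (by decide)) hK,
      div_pos (pos _ _ _ (by decide)) hK, ?_⟩
    have hK' := hK.ne'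
    ext
    · simp only [Prod.fst_add, Prod.smul_fst, Prod.fst_sub, smul_eq_mul]
      field_simp
      simp [det]; ring
    · simp only [Prod.snd_add, Prod.smul_snd, Prod.snd_sub, smul_eq_mul]
      field_simp
      simp [det]; ring
  set T := f 0 + t • (f 0 - f 4) with hT0
  obtain ⟨s, hs⟩ : ∃ s, SignIs (det (f 3) (f 5) T) s ∨
      det (f 3) (f 5) T = 0 ∧ SignIs (det 0 (f 5 - f 3) (f 0 - f 4 + (f 1 - f 2))) s ∨
      det (f 3) (f 5) T = 0 ∧ det 0 (f 5 - f 3) (f 0 - f 4 + (f 1 - f 2)) = 0 ∧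
        SignIs (det 0 (f 5 - f 3) (f 0 - f 4)) s := by
    refine exists_signIs fun ⟨_, h1, h2⟩ => ?_
    have h035 : 0 ≠ det (f 0) (f 3) (f 5) := (h.det_ne_zero (by norm_num) (by norm_num)
      (by norm_num) (by norm_num) (by norm_num) (by norm_num)).symm
    have hx : det 0 (f 0 - f 4) (f 2 - f 1) * ((f 5).1 - (f 3).1) = 0 := by
      simp only [det, Prod.fst_zero, Prod.snd_zero, sub_zero, Prod.fst_sub, Prod.snd_sub,
        Prod.fst_add, Prod.snd_add] at h1 h2 ⊢
      linear_combination ((f 1).1 - (f 2).1) * h2 - ((f 0).1 - (f 4).1) * (h1 - h2)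
    have hy : det 0 (f 0 - f 4) (f 2 - f 1) * ((f 5).2 - (f 3).2) = 0 := by
      simp only [det, Prod.fst_zero, Prod.snd_zero, sub_zero, Prod.fst_sub, Prod.snd_sub,
        Prod.fst_add, Prod.snd_add] at h1 h2 ⊢
      linear_combination ((f 1).2 - (f 2).2) * h2 - ((f 0).2 - (f 4).2) * (h1 - h2)
    rw [mul_eq_zero, or_iff_right hK.ne'] at hx hy
    refine h035 ?_
    simp only [det]
    linear_combination ((f 0).1 - (f 3).1) * hy - ((f 0).2 - (f 3).2) * hx
  have key : ∃ x, ∀ j < 6, ∀ i < j, SignIs (det (f i) (f j) x) (tipTable s i j 6) := by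
    refine exists_near 6 f T (f 0 - f 4 + (f 1 - f 2)) (f 0 - f 4) _ ?_
    have row0 : ∀ j, 0 < det (f 0) (f j) (f 4) → SignIs (det (f 0) (f j) T) false := by
      intro j hj
      rw [hT0, det_reflect, show det (f 0) (f 4) (f j) = -det (f 0) (f j) (f 4) by
        unfold det; ring, mul_neg]
      exact sgn' (mul_pos ht hj)
    have row1 : ∀ j, 0 < det (f 1) (f 2) (f j) → SignIs (det (f 1) (f j) T) true := by
      intro j hj
      rw [hT, det_reflect]
      exact sgn (mul_pos hu hj)
    have row2 : ∀ j, 0 < det (f 2) (f j) (f 1) → SignIs (det (f 2) (f j) T) true := by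
      intro j hj
      rw [hT, det_extend_left]
      exact sgn (mul_pos (by positivity) hj)
    have col4 : ∀ i, 0 < det (f i) (f 4) (f 0) → SignIs (det (f i) (f 4) T) true := by
      intro i hi
      rw [hT0, det_extend_right]
      exact sgn (mul_pos (by positivity) hi)
    have h45 : SignIs (det (f 4) (f 5) T) false := by
      rw [hT0, det_extend_left, show det (f 4) (f 5) (f 0) = -det (f 5) (f 4) (f 0) by
        unfold det; ring, mul_neg]
      exact sgn' (mul_pos (by positivity) (pos _ _ _ (by decide)))
    have h04 : det (f 0) (f 4) T = 0 ∧ SignIs (det 0 (f 4 - f 0) (f 0 - f 4 + (f 1 - f 2))) true :=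
      ⟨by rw [hT0, det_reflect]; simp [det, mul_comm], sgn (by
        convert hK using 1; simp [det]; ring)⟩
    have h12 : det (f 1) (f 2) T = 0 ∧
        SignIs (det 0 (f 2 - f 1) (f 0 - f 4 + (f 1 - f 2))) false :=
      ⟨by rw [hT, det_reflect]; simp [det, mul_comm], by
        convert sgn' hK using 1; simp [det]; ring⟩
    intro j hj i hi
    interval_cases j <;> interval_cases i
    exacts [Or.inl (row0 1 (pos _ _ _ (by decide))), Or.inl (row0 2 (pos _ _ _ (by decide))),
      Or.inr (Or.inl h12), Or.inl (row0 3 (pos _ _ _ (by decide))),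
      Or.inl (row1 3 (pos _ _ _ (by decide))), Or.inl (row2 3 (pos _ _ _ (by decide))),
      Or.inr (Or.inl h04), Or.inl (col4 1 (pos _ _ _ (by decide))),
      Or.inl (col4 2 (pos _ _ _ (by decide))), Or.inl (col4 3 (pos _ _ _ (by decide))),
      Or.inl (row0 5 (pos _ _ _ (by decide))), Or.inl (row1 5 (pos _ _ _ (by decide))),
      Or.inl (row2 5 (pos _ _ _ (by decide))), hs, Or.inl h45]
  refine h.exists_extension key ?_ (noHoles_tipTable s)
  intro k hk j hj i hi
  simp [tipTable, natBeq_eq_decide, hk.ne]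

lemma Realizes.tip_cases {f : ℕ → Pt} (h : Realizes 6 f pentagonTable) :
    0 < det 0 (f 0 - f 4) (f 2 - f 1) ∨ 0 < det 0 (f 2 - f 1) (f 4 - f 3) := by
  have n1 : 0 < det (f 0) (f 1) (f 2) := h 2 (by norm_num) 1 (by norm_num) 0 (by norm_num)
  have n2 : 0 < det (f 1) (f 2) (f 4) := h 4 (by norm_num) 2 (by norm_num) 1 (by norm_num)
  have n3 : 0 < det (f 0) (f 3) (f 4) := h 4 (by norm_num) 3 (by norm_num) 0 (by norm_num)
  have n4 : 0 < det (f 1) (f 3) (f 4) := h 4 (by norm_num) 3 (by norm_num) 1 (by norm_num)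
  have n5 : 0 < det (f 0) (f 1) (f 4) := h 4 (by norm_num) 1 (by norm_num) 0 (by norm_num)
  by_contra! hc
  obtain ⟨c1, c2⟩ := hc
  have e1 : det (f 1) (f 2) (f 4) =
      det (f 0) (f 1) (f 2) + det 0 (f 0 - f 4) (f 2 - f 1) := by simp [det]; ring
  have e2 : det (f 1) (f 3) (f 4) =
      det (f 0) (f 3) (f 4) + det 0 (f 4 - f 3) (f 1 - f 0) := by simp [det]; ring
  have e3 : det 0 (f 4 - f 3) (f 2 - f 1) * det (f 0) (f 1) (f 4) =
      det 0 (f 4 - f 3) (f 1 - f 0) * det 0 (f 0 - f 4) (f 2 - f 1) -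
        det (f 0) (f 3) (f 4) * det (f 0) (f 1) (f 2) := by simp [det]; ring
  have e4 : det 0 (f 4 - f 3) (f 2 - f 1) = -det 0 (f 2 - f 1) (f 4 - f 3) := by
    simp [det]; ring
  nlinarith [mul_nonneg (sub_nonneg.2 c2) n5.le, mul_pos n1 n4, mul_pos n3 n2]

lemma exists_extension_of_realizes_pentagonTable {f : ℕ → Pt} (h : Realizes 6 f pentagonTable) :
    ∃ x, x ∉ (Finset.range 6).image f ∧ GenPos (insert x ((Finset.range 6).image f)) ∧
      ¬∃ S, EmptyConvexPentagon (insert x ((Finset.range 6).image f)) S := by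
  rcases h.tip_cases with hK | hK
  · exact h.exists_tip hK
  · have h' : Realizes 6 (f ∘ fun i => [2, 3, 4, 0, 1, 5].getD i 0) pentagonTable :=
      h.comp _ (by decide) (by decide) (by decide)
    have himg : (Finset.range 6).image (f ∘ fun i => [2, 3, 4, 0, 1, 5].getD i 0) =
        (Finset.range 6).image f := by
      rw [← Finset.image_image]
      exact congrArg _ (by decide)
    rw [← himg]
    exact h'.exists_tip hK

/-- No 6-point set is a bad configuration for the empty convex 5-gon game. -/
theorem stmt11 (P : Finset Pt) (hcard : P.card = 6) (hgp : GenPos P)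
    (hno : ¬ ∃ S, EmptyConvexPentagon P S) :
    ∃ x, x ∉ P ∧ GenPos (insert x P) ∧
      ¬ ∃ S, EmptyConvexPentagon (insert x P) S := by
  obtain ⟨f, rfl, hf⟩ := hgp.exists_sorted hcard
  have hinj : Set.InjOn f (Finset.range (5 + 1)) :=
    Finset.card_image_iff.1 (by rw [hcard, Finset.card_range])
  have hne : ∀ i < 6, ∀ j < i, f j ≠ f i := fun i hi j hj he =>
    hj.ne (hinj (by simp; omega) (by simp; omega) he)
  have hdet : ∀ k < 6, ∀ j < k, ∀ i < j, det (f i) (f j) (f k) ≠ 0 := fun k hk j hj i hi =>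
    hgp.det_ne_zero (Finset.mem_image_of_mem f (by simp; omega))
      (Finset.mem_image_of_mem f (by simp; omega)) (Finset.mem_image_of_mem f (by simp; omega))
      (hne j (by omega) i hi) (hne k hk i (by omega)) (hne k hk j hj)
  set b : ℕ → ℕ → ℕ → Bool := fun i j k => decide (0 < det (f i) (f j) (f k)) with hb
  have hreal : Realizes 6 f (fanTable (b 1 2 3) (b 1 2 4) (b 1 2 5) (b 1 3 4) (b 1 3 5)
      (b 1 4 5) (b 2 3 4) (b 2 3 5) (b 2 4 5) (b 3 4 5)) := by
    intro k hk j hj i hi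
    refine signIs_of_iff (hdet k hk j hj i hi) ?_
    have hpos := hf k hk j hj
    interval_cases k <;> interval_cases j <;> interval_cases i <;> simp [fanTable, hb, hpos]
  have hcases := fanTable_cases (b 1 2 3) (b 1 2 4) (b 1 2 5) (b 1 3 4) (b 1 3 5)
      (b 1 4 5) (b 2 3 4) (b 2 3 5) (b 2 4 5) (b 3 4 5)
  have hblk : ((List.range 6).all fun i => isBlocked 6 (altExtend (fanTable (b 1 2 3) (b 1 2 4)
      (b 1 2 5) (b 1 3 4) (b 1 3 5) (b 1 4 5) (b 2 3 4) (b 2 3 5) (b 2 4 5) (b 3 4 5))) i i) =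
      true := by
    rw [List.all_eq_true]
    exact fun i hi => hreal.isBlocked_of_no_hole rfl hno (List.mem_range.1 hi)
  dsimp only at hcases
  rw [hblk] at hcases
  iterate 8 rw [hreal.plucker (by decide) (by decide)] at hcases
  simp only [Bool.not_true, Bool.false_or, Bool.or_eq_true, or_assoc] at hcases
  rcases hcases with hs | hs | hs | hs
  · rw [beq_iff_eq] at hs
    simp only [List.cons.injEq, and_true] at hs
    obtain ⟨h0, h1, h2, h3, h4, h5, h6, h7, h8, h9⟩ := hs
    rw [h0, h1, h2, h3, h4, h5, h6, h7, h8, h9] at hreal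
    have h' : Realizes 6 (f ∘ fun i => [0, 1, 2, 4, 5, 3].getD i 0) pentagonTable :=
      hreal.comp _ (by decide) (by decide) (by decide)
    have himg : (Finset.range 6).image (f ∘ fun i => [0, 1, 2, 4, 5, 3].getD i 0) =
        (Finset.range (5 + 1)).image f := by
      rw [← Finset.image_image]
      exact congrArg _ (by decide)
    rw [← himg]
    exact exists_extension_of_realizes_pentagonTable h'
  · exact hreal.exists_double (by norm_num) (by norm_num) (by norm_num) true hs
  · exact hreal.exists_double (by norm_num) (by norm_num) (by norm_num) false hs
  · exact hreal.exists_double (by norm_num) (by norm_num) (by norm_num) true hs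
end
end

section
/- Every planar point set of 10 points in general position contains an empty convex pentagon (H(5) = 10, upper bound direction). -/
open scoped Classical
noncomputable section

namespace EmptyPentagon

/-! ### A certificate checker for orientations of point triples

Triples of indices below `10` are coded by three-digit numbers. A *clause* is a disjunction of
*cubes*, and a cube is a conjunction of (positive) orientations of triples. -/

/-- The code of the oriented triple `(i, j, k)`, rotated so that the least index comes first. -/
def lit (i j k : ℕ) : ℕ :=
  if i < j ∧ i < k then 100 * i + 10 * j + k
  else if j < k then 100 * j + 10 * k + i
  else 100 * k + 10 * i + j

/-- The code of the triple with the opposite orientation. -/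
def neg (n : ℕ) : ℕ := 100 * (n / 100) + 10 * (n % 10) + n / 10 % 10

/-- The triple coded by `n` is positively oriented. -/
def Holds (p : ℕ → Pt) (n : ℕ) : Prop := 0 < det (p (n / 100)) (p (n / 10 % 10)) (p (n % 10))

/-- Every triple of distinct points is oriented one way or the other. -/
def orientClause (a b c : ℕ) : List (List ℕ) :=
  if [a, b, c].Nodup then [[lit a b c], [lit a c b]] else [[]]

/-- The three products in the Grassmann–Plücker relation of five points are not all positive;
the Booleans give the signs of the factors of the second and the third product. -/
def plueckerClause (a b c d e : ℕ) (s t : Bool) : List (List ℕ) :=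
  if [a, b, c, d, e].Nodup then
    [[lit a c b], [lit a e d],
      [if s then lit a d b else lit a b d], [if s then lit a c e else lit a e c],
      [if t then lit a b e else lit a e b], [if t then lit a c d else lit a d c]]
  else [[]]

/-- A pentagon is not convex, or some other point is on the inner side of all its edges. -/
def pentagonClause (a b c d e : ℕ) : List (List ℕ) :=
  if [a, b, c, d, e].Nodup then
    [[lit a c b], [lit a d b], [lit a e b], [lit a d c], [lit a e c], [lit a e d],
      [lit b d c], [lit b e c], [lit b e d], [lit c e d]] ++
    ((List.range 10).filter fun x => x ∉ [a, b, c, d, e]).map fun x =>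
      [lit a b x, lit b c x, lit c d x, lit d e x, lit e a x]
  else [[]]

/-- The clause coded by a number: the leading digit gives the kind of clause, the other digits its
parameters. -/
def clause (n : ℕ) : List (List ℕ) :=
  if n < 10 ^ 4 then orientClause (n / 100 % 10) (n / 10 % 10) (n % 10)
  else if n < 10 ^ 6 then
    pentagonClause (n / 10 ^ 4 % 10) (n / 10 ^ 3 % 10) (n / 100 % 10) (n / 10 % 10) (n % 10)
  else
    plueckerClause (n / 10 ^ 6 % 10) (n / 10 ^ 5 % 10) (n / 10 ^ 4 % 10) (n / 10 ^ 3 % 10)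
      (n / 100 % 10) (n / 10 % 10 == 1) (n % 10 == 1)

/-- Add a cube to a set of triples, the set being coded by the bits of a number. -/
def extend (g : ℕ) (c : List ℕ) : ℕ := c.foldl (fun g l => g ||| 2 ^ l) g

/-- Refute all the sets of triples in the second list, where each clause of the certificate replaces
the first set by its extensions by the cubes of the clause. -/
def refute : List ℕ → List ℕ → Bool
  | _, [] => true
  | [], _ :: _ => false
  | n :: ns, g :: gs =>
    refute ns
      ((((clause n).filter fun c => !c.any fun l => g.testBit (neg l)).map (extend g)) ++ gs)

/-- The triples that are positive since the points are sorted by angle around the point `0`. -/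
def sortedTriples : ℕ :=
  extend 0 ((List.range 10).flatMap fun k =>
    ((List.range k).filter (0 < ·)).map fun j => lit 0 j k)

/-- A certificate that every ten points sorted by angle contain an empty convex pentagon. -/
def certificate : List ℕ :=
  [
    1234, 1134, 1235, 1356, 1123, 31234000, 201234, 1345, 34025300, 202345, 35046300, 1264,
    33025601, 34026300, 34025601, 35026300, 223564, 36047500, 36048500, 36049500, 1124, 32014601,
    34016200, 201246, 1346, 32346000, 202346, 1245, 35026400, 202456, 1467, 34026701, 36027400,
    202467, 1567, 36047500, 1135, 32015401, 34025100, 213542, 35047300, 35048300, 35049300,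
    36047300, 34037601, 1357, 35047300, 235764, 37068500, 37069500, 1587, 33017501, 35037100,
    35038701, 37058300, 33018501, 35038100, 37038100, 218753, 38079100, 33017501, 37068500, 1468,
    34026801, 36028400, 202468, 1568, 36048500, 1789, 37068901, 38069700, 206789, 1358, 34038601,
    35048300, 36048300, 235864, 38069500, 1457, 35047801, 37048500, 245786, 31345000, 1597,
    35037100, 35039701, 37059300, 33019501, 35039100, 37039100, 219753, 1387, 33018701, 37038100,
    37039801, 38079300, 33019701, 37039100, 38039100, 219873, 1237, 34027501, 35047200, 223754,
    37069500, 1698, 36059801, 38069500, 257986, 35037100, 32357000, 1485, 33485000, 37048300,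
    237854, 1397, 31273000, 33019701, 33029701, 37039100, 37039200, 31293000, 219732, 1469,
    34026901, 36029400, 202469, 1589, 35048901, 36049500, 38049500, 245896, 31345000, 35039801,
    38059300, 237985, 1456, 1123, 31234000, 201234, 1345, 34025300, 202345, 1245, 34025601,
    35026400, 202456, 1567, 35046701, 36047500, 204567, 36057300, 35037601, 1153, 33016501,
    33017501, 35036100, 35037100, 36037100, 217653, 37068100, 37069100, 1347, 33475000, 1687,
    36038701, 36058701, 37068300, 37068500, 33586000, 238765, 38079300, 1142, 32015401, 34025100,
    213542, 35048300, 35049300, 1568, 35046801, 36048500, 204568, 1467, 36047801, 37048600,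
    204678, 1789, 37068901, 38069700, 206789, 1246, 32014601, 34016200, 201246, 1378, 35038601,
    36058300, 37058300, 237865, 1257, 34027601, 35047200, 35027601, 36047200, 225764, 37069500,
    37039801, 1273, 32017301, 33027100, 33029701, 37039200, 32019301, 33029100, 37029100, 219732,
    1173, 33018701, 33019701, 37038100, 37039100, 38079300, 38039100, 219873, 1587, 33587000,
    33597000, 37059801, 38079300, 38079500, 239875, 1152, 32017501, 35027100, 213752, 1475,
    32475000, 223754, 1265, 33027601, 36057200, 223765, 1486, 35047801, 37048500, 245786,
    34015601, 1164, 32015601, 34015601, 35016200, 212564, 36049500, 34016801, 36018400, 201468,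
    1136, 1123, 31234000, 201234, 1345, 34025300, 202345, 33465000, 1576, 35037601, 35047601,
    36057300, 36057400, 33475000, 237654, 37068300, 37069300, 1678, 36057801, 37058600, 205678,
    1586, 35038601, 35048601, 36058300, 36058400, 33485000, 238654, 38069300, 1476, 34037601,
    36047300, 36048701, 37068400, 34038601, 36048300, 37048300, 238764, 38079300, 33026100, 1254,
    34026501, 35046200, 223654, 36059300, 1124, 32014501, 34015200, 201245, 1457, 34025701,
    35027400, 202457, 1264, 32016401, 34026100, 213642, 36048300, 36049300, 35047300, 1367,
    33475000, 236754, 37059600, 36027400, 34026701, 1273, 32347000, 1275, 32567000, 224675,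
    37059600, 1798, 36038701, 37068300, 37069801, 38079600, 36039701, 37069300, 38069300, 239876,
    1278, 37028901, 38029700, 202789, 37028500, 1579, 35027901, 37029500, 202579, 1468, 35048701,
    37058400, 246875, 34016501, 1689, 36058901, 37059600, 38059600, 256897, 35016701, 34038601,
    36048300, 36049801, 38069400, 34039601, 36049300, 38049300, 239864, 1239, 1123, 31234000,
    201234, 1345, 34025300, 202345, 33465000, 1576, 35037601, 35047601, 36057300, 36057400,
    33475000, 237654, 37068300, 37069300, 1678, 36057801, 37058600, 205678, 1586, 35038601,
    35048601, 36058300, 36058400, 33485000, 238654, 38069300, 1476, 34037601, 36047300, 36048701,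
    37068400, 34038601, 36048300, 37048300, 238764, 38079300, 1376, 33017601, 36037100, 36038701,
    37068300, 33018601, 36038100, 37038100, 218763, 38079100, 1475, 34037501, 35047300, 236754,
    37059600, 1347, 33024701, 34027300, 202347, 1245, 34025701, 35027400, 202457, 1578, 35047801,
    37048500, 204578, 1236, 34026501, 35046200, 223654, 36059300, 1386, 31263000, 33018601,
    33028601, 36038100, 36038200, 31283000, 218632, 1485, 34038501, 35048300, 36048300, 236854,
    38059600, 1375, 35038701, 37058300, 236875, 38079600, 1274, 33025701, 35027300, 223574,
    37049500, 1478, 34027801, 37028400, 202478, 1358, 34038701, 37048300, 235874, 38079500,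
    33029601, 36059300, 1598, 35039801, 38059300, 38059600, 236985, 1798, 38079500, 1497,
    35048901, 37049500, 38049500, 245897, 34015701, 34027901, 37029400, 202479, 1123, 31234000,
    201234, 1345, 34025300, 202345, 33465000, 1576, 35037601, 35047601, 36057300, 36057400,
    33475000, 237654, 37068300, 37069300, 1678, 36057801, 37058600, 205678, 1586, 35038601,
    35048601, 36058300, 36058400, 33485000, 238654, 38069300, 1476, 34037601, 36047300, 36048701,
    37068400, 34038601, 36048300, 37048300, 238764, 38079300, 1376, 33017601, 36037100, 36038701,
    37068300, 33018601, 36038100, 37038100, 218763, 38079100, 1475, 34037501, 35047300, 236754,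
    37059600, 1347, 33024701, 34027300, 202347, 1245, 34025701, 35027400, 202457, 1578, 35047801,
    37048500, 204578, 1236, 34026501, 35046200, 223654, 1386, 31263000, 33018601, 33028601,
    36038100, 36038200, 31283000, 218632, 38069100, 1485, 34038501, 35048300, 36048300, 236854,
    38059600, 1375, 35038701, 37058300, 236875, 38079600, 33025701, 1274, 35027300, 223574, 1478,
    34027801, 37028400, 202478, 1358, 34038701, 37048300, 235874, 33025901, 32349000, 33025901,
    33027901, 34027901, 35037901, 1689, 36038901, 36058901, 38039600, 38059600, 236895, 37039600,
    1589, 35048901, 38049500, 38079500, 245897, 34015701, 1396, 31263000, 32019301, 33029100,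
    36039100, 36039200, 219632, 36059300, 38059300, 236985, 1123, 31234000, 201234, 1345,
    33024501, 33025100, 32015301, 1145, 31345000, 1365, 33016501, 33026501, 35036100, 35036200,
    31263000, 216532, 36057100, 36058100, 36059100, 35046300, 1346, 33024601, 34026300, 202346,
    1567, 35046701, 36047500, 204567, 1375, 33017501, 33027501, 35037100, 35037200, 31273000,
    217532, 37058100, 37059100, 35047300, 1476, 34037601, 36047300, 235764, 37068500, 37069500,
    1347, 33024701, 34027300, 202347, 1678, 36047801, 37048600, 204678, 37068500, 36058701, 1165,
    35017601, 35018601, 36057100, 36058100, 37058100, 218765, 38079100, 1798, 37059801, 37069801,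
    38079500, 38079600, 35697000, 259876, 35026100, 1385, 33018501, 33028501, 35038100, 35038200,
    31283000, 218532, 38059100, 1263, 32016301, 33026100, 35026100, 215632, 36039500, 1679,
    36047901, 37049600, 204679, 1478, 37048901, 38049700, 204789, 1486, 34038601, 35048300,
    36048300, 235864, 38069500, 1376, 36038701, 37068300, 235876, 1274, 33026701, 34026701,
    36027300, 223674, 37069500, 36059701, 1589, 38069500, 258976, 32365000, 1368, 34038701,
    37048300, 236874, 1479, 34027901, 37029400, 202479, 1395, 33019501, 33029501, 35039100,
    35039200, 31293000, 219532, 1698, 36039801, 38069300, 235986, 36048901, 38049600, 246897,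
    34016701, 1123, 33014200, 1345, 33024501, 34025300, 202345, 34035100, 33015401, 1125,
    31253000, 1465, 34016501, 34036501, 35046100, 35046300, 31364000, 216543, 36057100, 36058100,
    36059100, 1346, 33024601, 34026300, 202346, 1567, 35046701, 36047500, 204567, 1156, 33016401,
    34036100, 35036100, 215643, 36048500, 36049500, 35017601, 1475, 31375000, 31475000, 34037501,
    35047300, 217543, 37058100, 37059100, 1365, 31365000, 31375000, 35037601, 36057100, 36057300,
    217653, 37068100, 37069100, 1687, 36057100, 36058701, 37068500, 35018601, 36058100, 37058100,
    218765, 38079100, 1568, 35046801, 36048500, 204568, 1467, 36047801, 37048600, 204678, 1789,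
    37068901, 38069700, 206789, 1357, 34037601, 36047300, 235764, 37069500, 1597, 31375000,
    35019701, 35039701, 37059100, 37059300, 31395000, 219753, 1697, 37069500, 1587, 37059801,
    1253, 31275000, 31375000, 33027501, 35037200, 217532, 1698, 36059801, 38069500, 257986,
    35026300, 1486, 35047801, 37048500, 245786, 34025601, 1264, 33025601, 34025601, 35026300,
    223564, 36049500, 36048901, 34026901, 36029400, 202469, 1134, 34130201, 33024100, 1345,
    33014501, 34015300, 201345, 34035200, 33025401, 1465, 34026501, 34036501, 35046200, 35046300,
    32364000, 226543, 36057200, 36058200, 36059200, 1346, 33014601, 34016300, 201346, 1567,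
    35046701, 36047500, 204567, 1256, 33026401, 34036200, 35036200, 225643, 36048500, 36049500,
    36057200, 35027601, 1475, 32375000, 32475000, 34037501, 35047300, 227543, 37058200, 37059200,
    1237, 32375000, 1365, 32365000, 35037601, 36057300, 227653, 37068200, 37069200, 1247,
    32475000, 1687, 36028701, 36058701, 37068200, 37068500, 32586000, 228765, 32018501, 38079200,
    1568, 35046801, 36048500, 204568, 1467, 36047801, 37048600, 204678, 1789, 37068901, 38069700,
    206789, 1278, 35028601, 36058200, 37058200, 227865, 32017501, 1357, 34037601, 36047300,
    235764, 37069500, 1172, 32018701, 37028100, 37029801, 38079200, 32019701, 37029100, 38029100,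
    219872, 1597, 35029701, 35039701, 37059200, 37059300, 32395000, 229753, 1697, 37069500, 1587,
    37059801, 1153, 32017501, 33017501, 35037100, 212753, 1698, 36059801, 38069500, 257986,
    35016300, 1486, 35047801, 37048500, 245786, 34015601, 1164, 33015601, 34015601, 35016300,
    213564, 36049500, 36048901, 34016901, 36019400, 201469, 1345, 1245, 1145, 1346, 1467, 1456,
    35036400, 203456, 36057400, 1375, 34036701, 35037400, 35036701, 36037400, 234675, 37058600,
    37059600, 1235, 33025701, 35027300, 202357, 1457, 33457000, 203457, 1356, 36037500, 203567,
    1578, 35037801, 37038500, 203578, 1678, 37058600, 1132, 31243000, 32015301, 33025100, 214532,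
    35038400, 35039400, 1246, 33026501, 35036200, 224653, 36058400, 36059400, 1468, 35048701,
    36058400, 37058400, 246875, 38079600, 1142, 32016401, 34026100, 34028601, 36048200, 32018401,
    34028100, 36028100, 218642, 38069100, 1135, 33015701, 35017300, 201357, 31245000, 212453,
    34028601, 35039400, 1567, 1456, 35036400, 203456, 34576000, 1356, 35036701, 36037500, 203567,
    1678, 36057801, 37058600, 205678, 37068400, 36048701, 1264, 34027601, 34028601, 36047200,
    36048200, 37048200, 228764, 32018401, 38079200, 1458, 34586000, 1798, 37049801, 37069801,
    38079400, 38079600, 34697000, 249876, 34019601, 1253, 33026501, 35036200, 224653, 31243000,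
    36059400, 1679, 36057901, 37059600, 205679, 1578, 37058901, 38059700, 205789, 1123, 32013501,
    33015200, 201235, 1357, 33025701, 35027300, 202357, 37069400, 36049701, 1489, 38069400,
    248976, 34018601, 1368, 35038701, 36058300, 36038701, 37058300, 236875, 33016501, 32014301,
    1384, 33018401, 33028401, 34038100, 34038200, 31283000, 218432, 38049100, 34597000, 1394,
    33019401, 33029401, 34039100, 34039200, 31293000, 219432, 1284, 32018401, 34028100, 34029801,
    38049200, 32019401, 34029100, 38029100, 219842, 1263, 33028601, 36038200, 224863, 1698,
    36039801, 38069300, 234986, 1586, 33586000, 234865, 1376, 34038701, 37068300, 234876, 1275,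
    33026701, 35026701, 36027300, 223675, 1597, 36058901, 38059600, 256897, 35016701, 35027901,
    37029500, 202579, 1247, 1456, 35036400, 203456, 34576000, 1687, 36048701, 36058701, 37068400,
    37068500, 34586000, 248765, 38079400, 1789, 37068901, 38069700, 206789, 1587, 35048701,
    37058400, 37059801, 38079500, 35049701, 37059400, 38059400, 249875, 34037200, 1365, 35037601,
    36057300, 234765, 37069400, 1235, 33025601, 35026300, 202356, 1568, 35036801, 36038500,
    203568, 1367, 36037801, 37038600, 203678, 1132, 31243000, 32015301, 33025100, 214532,
    35038400, 35039400, 1375, 33027501, 35037200, 224753, 37059400, 1265, 34027601, 35027601,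
    36057200, 224765, 31245000, 37069400, 1478, 35048601, 36058400, 247865, 1236, 32013601,
    33016200, 201236, 1135, 33015601, 35016300, 201356, 1386, 35037801, 37038500, 235786, 1257,
    33027601, 36037200, 225763, 37069500, 1124, 31245000, 212453, 33568000, 35039400, 1136,
    33016801, 36018300, 201368, 1174, 34018701, 37048100, 37049801, 38079400, 34019701, 37049100,
    38049100, 219874, 1125, 32015601, 35016200, 212563, 36039500, 32017501, 35027100, 214752,
    37059400, 1456, 35036400, 203456, 34576000, 1687, 36048701, 36058701, 37068400, 37068500,
    34586000, 248765, 38079400, 1789, 37068901, 38069700, 206789, 1587, 35048701, 37058400,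
    37059801, 38079500, 35049701, 37059400, 38059400, 249875, 1487, 34028701, 37048200, 37049801,
    38079400, 34029701, 37049200, 38049200, 229874, 32019401, 1586, 35048601, 36058400, 247865,
    1356, 35036801, 36038500, 203568, 1689, 36058901, 38059600, 205689, 1347, 35037601, 36057300,
    234765, 37069400, 1132, 31243000, 32374000, 33017401, 34037100, 31273000, 217432, 37049100,
    1497, 32374000, 34029701, 34039701, 37049200, 37049300, 32394000, 229743, 1235, 32013501,
    33015200, 201235, 1486, 36049801, 37069400, 38069400, 247986, 34037100, 1246, 33026501,
    35036200, 224653, 36059400, 1385, 34036801, 35038400, 36038400, 234685, 1142, 32016401,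
    32017401, 34026100, 34027100, 36047200, 36027100, 217642, 37069100, 1135, 33015801, 35018300,
    201358, 31245000, 212453, 35039400, 1456, 34035601, 34036100, 33016401, 34036200, 33026401,
    1126, 31263000, 31264000, 212643, 36047200, 36048200, 36049200, 1132, 31243000, 216432,
    36047100, 36048100, 36049100, 1256, 32456000, 1476, 34027601, 34037601, 36047200, 36047300,
    32374000, 227643, 37068200, 37069200, 36150401, 1235, 32013501, 33015200, 201235, 36057400,
    1457, 34035701, 35037400, 203457, 1678, 36057801, 37058600, 205678, 1276, 32017601, 36027100,
    36028701, 37068200, 32018601, 36028100, 37028100, 218762, 38079100, 1486, 34028601, 34038601,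
    36048200, 36048300, 32384000, 228643, 38069200, 1374, 33027401, 34037200, 36037200, 226743,
    37049600, 36058400, 1587, 35048701, 37058400, 246875, 38079600, 1357, 35037801, 37038500,
    203578, 1789, 37058901, 38059700, 205789, 1247, 33027501, 35037200, 224753, 37059400,
    38079600, 1176, 36018701, 36798000, 37068100, 36019701, 37069100, 38069100, 219876, 1142,
    32017401, 34027100, 216742, 36798000, 1286, 32018601, 36028100, 36029801, 38069200, 32019601,
    36029100, 38029100, 219862, 1153, 31245000, 212453, 35038400, 35039400, 1487, 34028701,
    37048200, 226874, 1358, 33015801, 35018300, 201358, 34037801, 35038400, 37038400, 234785,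
    1456, 34035601, 35036400, 203456, 34015200, 35046100, 34016501, 1126, 31264000, 1136,
    31364000, 1576, 35017601, 35047601, 36057100, 36057400, 31475000, 217654, 37068100, 37069100,
    1457, 34035701, 35037400, 203457, 1356, 35036701, 36037500, 203567, 1678, 36057801, 37058600,
    205678, 1167, 34017501, 35047100, 36047100, 216754, 37059600, 1476, 31476000, 36018701,
    36048701, 37068100, 37068400, 31486000, 218764, 38079100, 1798, 36018701, 37068100, 37069801,
    38079600, 36019701, 37069100, 38069100, 219876, 1578, 37058901, 38059700, 205789, 1468,
    35048701, 36058400, 37058400, 246875, 1264, 34018601, 34028601, 36048100, 36048200, 31284000,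
    218642, 38069100, 1364, 34036200, 1253, 33026501, 35036200, 224653, 36059400, 1375, 34036701,
    36037400, 234675, 37059600, 33025701, 35027300, 202357, 1456, 34035601, 35036400, 203456,
    35046200, 34026501, 1236, 32364000, 1576, 35027601, 35047601, 36057200, 36057400, 32475000,
    227654, 32017401, 37068200, 37069200, 1457, 34035701, 35037400, 203457, 1678, 36057801,
    37058600, 205678, 1267, 34027501, 35047200, 36047200, 226754, 32016401, 37059600, 1162,
    32017601, 36027100, 36028701, 37068200, 32018601, 36028100, 37028100, 218762, 38079100, 1586,
    35028601, 35048601, 36058200, 36058400, 32485000, 228654, 32016401, 38069200, 1476, 32476000,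
    36028701, 36048701, 37068200, 37068400, 32486000, 228764, 31264000, 38079200, 1798, 36028701,
    37068200, 37069801, 38079600, 36029701, 37069200, 38069200, 229876, 1364, 32016301, 32016401,
    33016401, 34036100, 212643, 36048200, 36049200, 1375, 34036701, 35036701, 36037400, 234675,
    37059600, 1579, 35037901, 37039500, 203579, 1578, 37058901, 1689, 36058901, 37059600,
    38059600, 256897, 35016701, 1468, 35048701, 37058400, 246875, 34016501, 34028601, 36048200,
    36049801, 38069400, 34029601, 36049200, 38049200, 229864, 31264000, 1348, 34035100, 33015401,
    34035200, 33025401, 1125, 31253000, 31254000, 212543, 35046200, 35047200, 35049200, 1132,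
    31243000, 215432, 35046100, 35047100, 35049100, 1465, 34026501, 34036501, 35046200, 35046300,
    32364000, 226543, 36057200, 36059200, 1567, 35046701, 36047500, 204567, 1265, 32016501,
    35026100, 35027601, 36057200, 32017501, 35027100, 36027100, 217652, 37068100, 37069100, 1475,
    34027501, 34037501, 35047200, 35047300, 32374000, 227543, 37059200, 1365, 35036200, 1364,
    33026401, 34036200, 225643, 36049500, 1236, 32013601, 33016200, 201236, 1467, 34036701,
    36037400, 203467, 34038501, 1687, 36048701, 36058701, 37068400, 37068500, 245876, 38079500,
    1468, 36038400, 203468, 1367, 36037801, 37038600, 203678, 1568, 36048500, 1789, 37068901,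
    38069700, 206789, 1578, 37048500, 245786, 1247, 33027601, 34037200, 34027601, 36037200,
    224763, 37069400, 38079500, 37059801, 1275, 32017501, 35027100, 35029701, 37059200, 32019501,
    35029100, 37029100, 219752, 1175, 35018701, 35019701, 37058100, 37059100, 38059100, 219875,
    1285, 32018501, 35028100, 35029801, 38059200, 32019501, 35029100, 38029100, 219852, 1142,
    32017401, 34027100, 215742, 1487, 34028701, 37048200, 225874, 1374, 32374000, 35037200,
    225743, 1264, 36047200, 225764, 1163, 32014601, 34016200, 212463, 36039400, 1386, 37038400,
    234786, 33016801, 36018300, 201368, 34035200, 33025401, 1125, 32015301, 32015401, 33015401,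
    34035100, 212543, 35046200, 35047200, 35048200, 35049200, 1465, 34026501, 34036501, 35046200,
    35046300, 32364000, 226543, 31265000, 36057200, 36058200, 36059200, 1567, 35046701, 36047500,
    204567, 1265, 32016501, 35026100, 35027601, 36057200, 32017501, 35027100, 36027100, 217652,
    37068100, 37069100, 1475, 34027501, 34037501, 35047200, 35047300, 32374000, 227543, 31275000,
    37058200, 37059200, 1364, 33026401, 34036200, 35036200, 225643, 36048500, 36049500, 1467,
    34036701, 36037400, 203467, 34038200, 33028401, 34036801, 36048500, 1578, 35047801, 37048500,
    37068500, 245786, 34035100, 38069700, 1485, 35048200, 35048300, 228543, 31285000, 38059200,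
    1275, 32017501, 35027100, 35028701, 37058200, 32018501, 35028100, 37028100, 218752, 38079100,
    1687, 37068400, 245876, 34035100, 38079500, 1374, 33027401, 34037200, 35037200, 225743,
    37049500, 1278, 33478000, 38270301, 1789, 37068901, 38069700, 206789, 34037801, 38079200,
    1569, 35697000, 37059801, 38079500, 37059801, 1459, 37049801, 38079400, 245987, 34035100,
    34029501, 34039501, 35049200, 35049300, 32394000, 229543, 31295000]

theorem refute_certificate : refute certificate [sortedTriples] = true := by
  decide +kernel

/-! ### Soundness of the checker -/

theorem det_rotate (p q r : Pt) : det q r p = det p q r := by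
  unfold det; ring

theorem det_swap (p q r : Pt) : det p r q = -det p q r := by
  unfold det; ring

theorem holds_lit (p : ℕ → Pt) {i j k : ℕ} (hi : i < 10) (hj : j < 10) (hk : k < 10) :
    Holds p (lit i j k) ↔ 0 < det (p i) (p j) (p k) := by
  have code {a b c : ℕ} (ha : a < 10) (hb : b < 10) (hc : c < 10) :
      Holds p (100 * a + 10 * b + c) ↔ 0 < det (p a) (p b) (p c) := by
    unfold Holds
    rw [show (100 * a + 10 * b + c) / 100 = a by omega,
      show (100 * a + 10 * b + c) / 10 % 10 = b by omega,
      show (100 * a + 10 * b + c) % 10 = c by omega]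
  unfold lit
  split_ifs
  · exact code hi hj hk
  · rw [code hj hk hi, det_rotate]
  · rw [code hk hi hj, ← det_rotate]

theorem not_holds_of_holds_neg {p : ℕ → Pt} {n : ℕ} (h : Holds p (neg n)) : ¬ Holds p n := by
  unfold Holds neg at *
  have : n % 10 < 10 := n.mod_lt (by decide)
  have : n / 10 % 10 < 10 := (n / 10).mod_lt (by decide)
  generalize n / 100 = i, n / 10 % 10 = j, n % 10 = k at *
  rw [show (100 * i + 10 * k + j) / 100 = i by omega,
    show (100 * i + 10 * k + j) / 10 % 10 = k by omega,
    show (100 * i + 10 * k + j) % 10 = j by omega, det_swap] at h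
  linarith

/-- All triples in the set coded by `g` are positively oriented. -/
def Models (p : ℕ → Pt) (g : ℕ) : Prop := ∀ n, g.testBit n = true → Holds p n

theorem Models.extend {p : ℕ → Pt} {g : ℕ} (hg : Models p g) {c : List ℕ}
    (hc : ∀ l ∈ c, Holds p l) : Models p (extend g c) := by
  induction c generalizing g with
  | nil => exact hg
  | cons l c ih =>
    refine ih (g := g ||| 2 ^ l) (fun n hn => ?_) fun m hm => hc m (List.mem_cons_of_mem _ hm)
    rw [Nat.testBit_or, Nat.testBit_two_pow, Bool.or_eq_true, decide_eq_true_eq] at hn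
    rcases hn with hn | rfl
    · exact hg n hn
    · exact hc _ List.mem_cons_self

theorem not_models_of_refute {p : ℕ → Pt} (hp : ∀ n, ∃ c ∈ clause n, ∀ l ∈ c, Holds p l)
    {ns gs : List ℕ} (h : refute ns gs = true) {g : ℕ} (hg : g ∈ gs) : ¬ Models p g := by
  induction ns generalizing gs g with
  | nil => cases gs <;> simp_all [refute]
  | cons n ns ih =>
    cases gs with
    | nil => simp at hg
    | cons g' gs =>
      rw [refute] at h
      rcases List.mem_cons.1 hg with rfl | hg
      · intro hm
        obtain ⟨c, hc, hl⟩ := hp n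
        refine ih h (List.mem_append_left _ (List.mem_map_of_mem (a := c) ?_)) (hm.extend hl)
        simp only [List.mem_filter, hc, true_and, Bool.not_eq_true', List.any_eq_false]
        exact fun l hlc hb => not_holds_of_holds_neg (hm _ hb) (hl l hlc)
      · exact ih h (List.mem_append_right _ hg)

/-! ### Convexity and emptiness in terms of orientations -/

theorem convex_setOf_det_nonneg (p q : Pt) : Convex ℝ {x | 0 ≤ det p q x} := by
  intro x hx y hy s t hs ht hst
  rw [Set.mem_ofPred_eq] at *
  have : det p q (s • x + t • y) = s * det p q x + t * det p q y := by
    obtain rfl : t = 1 - s := by linarith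
    simp only [det, Prod.fst_add, Prod.snd_add, Prod.smul_fst, Prod.smul_snd, smul_eq_mul]
    ring
  rw [this]
  positivity

theorem notMem_convexHull_of_det_neg {p q x : Pt} {T : Set Pt} (hT : ∀ y ∈ T, 0 ≤ det p q y)
    (hx : det p q x < 0) : x ∉ convexHull ℝ T := fun h =>
  absurd (convexHull_min (t := {x | 0 ≤ det p q x}) hT (convex_setOf_det_nonneg p q) h)
    (not_le.2 hx)

theorem emptyConvexPentagon_of_det_pos {P : Finset Pt} {a b c d e : Pt}
    (ha : a ∈ P) (hb : b ∈ P) (hc : c ∈ P) (hd : d ∈ P) (he : e ∈ P)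
    (hcard : ({a, b, c, d, e} : Finset Pt).card = 5)
    (habc : 0 < det a b c) (habd : 0 < det a b d) (habe : 0 < det a b e) (hacd : 0 < det a c d)
    (hace : 0 < det a c e) (hade : 0 < det a d e) (hbcd : 0 < det b c d) (hbce : 0 < det b c e)
    (hbde : 0 < det b d e) (hcde : 0 < det c d e)
    (hP : ∀ x ∈ P, x ∉ ({a, b, c, d, e} : Finset Pt) →
      det a b x < 0 ∨ det b c x < 0 ∨ det c d x < 0 ∨ det d e x < 0 ∨ det e a x < 0) :
    EmptyConvexPentagon P {a, b, c, d, e} := by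
  refine ⟨?_, hcard, ?_, fun x hx hxS hi => ?_⟩
  · simp [Finset.insert_subset_iff, *]
  · have ear {u v w r s : Pt} (h1 : 0 < det u v w) (h2 : 0 < det u w r) (h3 : 0 < det u w s) :
        v ∉ convexHull ℝ ({u, w, r, s} : Set Pt) := by
      refine notMem_convexHull_of_det_neg (p := u) (q := w) ?_ (by rw [det_swap]; linarith)
      rintro y (rfl | rfl | rfl | rfl)
      · exact le_of_eq (by unfold det; ring)
      · exact le_of_eq (by unfold det; ring)
      · exact h2.le
      · exact h3.le
    have mono {v u w r s : Pt}
        (hS : ({a, b, c, d, e} : Finset Pt) ⊆ {v, u, w, r, s})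
        (h : v ∉ convexHull ℝ ({u, w, r, s} : Set Pt)) :
        v ∉ convexHull ℝ ((({a, b, c, d, e} : Finset Pt).erase v : Finset Pt) : Set Pt) := by
      refine fun hv => h (convexHull_mono (fun y hy => ?_) hv)
      rw [Finset.mem_coe, Finset.mem_erase] at hy
      simpa [hy.1] using hS hy.2
    intro v hv
    simp only [Finset.mem_insert, Finset.mem_singleton] at hv
    rcases hv with rfl | rfl | rfl | rfl | rfl
    · refine mono ?_ (ear (u := e) (w := b) (r := c) (s := d) ?_ ?_ ?_)
      · intro y; simp; tauto
      all_goals rwa [← det_rotate]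
    · refine mono ?_ (ear habc hacd hace)
      intro y; simp; tauto
    · refine mono ?_ (ear (r := e) (s := a) hbcd hbde (by rwa [det_rotate]))
      intro y; simp; tauto
    · refine mono ?_ (ear (r := a) (s := b) hcde (by rwa [det_rotate]) (by rwa [det_rotate]))
      intro y; simp; tauto
    · refine mono ?_ (ear (u := d) (w := a) (r := b) (s := c) ?_ ?_ ?_)
      · intro y; simp; tauto
      all_goals rw [det_rotate]; try assumption
      all_goals rwa [det_rotate]
  · replace hi := interior_subset hi
    rcases hP x hx hxS with h | h | h | h | h <;>
    · refine notMem_convexHull_of_det_neg (fun y hy => ?_) h hi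
      simp only [Finset.coe_insert, Finset.coe_singleton, Set.mem_insert_iff,
        Set.mem_singleton_iff] at hy
      rcases hy with rfl | rfl | rfl | rfl | rfl <;> unfold det at * <;> linarith

/-! ### Validity of the clauses -/

theorem det_ne_zero {P : Finset Pt} (hgp : GenPos P) {a b c : Pt} (ha : a ∈ P) (hb : b ∈ P)
    (hc : c ∈ P) (hab : a ≠ b) (hac : a ≠ c) (hbc : b ≠ c) : det a b c ≠ 0 := by
  intro h
  refine hgp a ha b hb c hc hab hac hbc ?_
  rw [collinear_iff_of_mem (p₀ := a) (by simp)]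
  refine ⟨b - a, ?_⟩
  have hv : (b.1 - a.1) ≠ 0 ∨ (b.2 - a.2) ≠ 0 := by
    by_contra! h0
    exact hab (Prod.ext (by linarith) (by linarith))
  rintro y (rfl | rfl | rfl)
  · exact ⟨0, by simp⟩
  · exact ⟨1, by simp⟩
  · unfold det at h
    rcases hv with hv | hv
    · refine ⟨(y.1 - a.1) / (b.1 - a.1), Prod.ext ?_ ?_⟩
      · simp [hv]
      · simp; field_simp; linarith
    · refine ⟨(y.2 - a.2) / (b.2 - a.2), Prod.ext ?_ ?_⟩
      · simp; field_simp; linarith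
      · simp [hv]

theorem pluecker (a b c d e : Pt) :
    det a b c * det a d e + det a d b * det a c e + det a b e * det a c d = 0 := by
  unfold det; ring

variable {P : Finset Pt} {p : ℕ → Pt}

theorem exists_orientClause
    (hp : ∀ i < 10, ∀ j < 10, ∀ k < 10, i ≠ j → i ≠ k → j ≠ k → det (p i) (p j) (p k) ≠ 0)
    {a b c : ℕ} (ha : a < 10) (hb : b < 10) (hc : c < 10) :
    ∃ C ∈ orientClause a b c, ∀ l ∈ C, Holds p l := by
  unfold orientClause
  split_ifs with hn
  · simp only [List.nodup_cons, List.mem_cons, List.not_mem_nil, or_false, not_or,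
      not_false_eq_true, List.nodup_nil, and_true] at hn
    rcases (hp a ha b hb c hc hn.1.1 hn.1.2 hn.2).lt_or_gt with h | h
    · refine ⟨[lit a c b], by simp, ?_⟩
      simpa [holds_lit p ha hc hb, det_swap (p a) (p b)] using h
    · refine ⟨[lit a b c], by simp, ?_⟩
      simpa [holds_lit p ha hb hc] using h
  · simp

theorem det_pos_of_not_holds
    (hp : ∀ i < 10, ∀ j < 10, ∀ k < 10, i ≠ j → i ≠ k → j ≠ k → det (p i) (p j) (p k) ≠ 0)
    {i j k : ℕ} (hi : i < 10) (hj : j < 10) (hk : k < 10) (hij : i ≠ j) (hik : i ≠ k)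
    (hjk : j ≠ k) (h : ¬ Holds p (lit i k j)) : 0 < det (p i) (p j) (p k) := by
  rw [holds_lit p hi hk hj, det_swap, not_lt, neg_nonpos] at h
  exact lt_of_le_of_ne h (hp i hi j hj k hk hij hik hjk).symm

theorem exists_plueckerClause
    (hp : ∀ i < 10, ∀ j < 10, ∀ k < 10, i ≠ j → i ≠ k → j ≠ k → det (p i) (p j) (p k) ≠ 0)
    {a b c d e : ℕ} (ha : a < 10) (hb : b < 10) (hc : c < 10) (hd : d < 10) (he : e < 10)
    (s t : Bool) :
    ∃ C ∈ plueckerClause a b c d e s t, ∀ l ∈ C, Holds p l := by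
  unfold plueckerClause
  by_cases hn : [a, b, c, d, e].Nodup
  · rw [if_pos hn]
    by_contra! hcon
    simp only [List.forall_mem_cons, List.mem_singleton, forall_eq, exists_eq_left] at hcon
    obtain ⟨h1, h2, h3, h4, h5, h6⟩ := hcon
    simp only [List.nodup_cons, List.mem_cons, List.not_mem_nil, or_false, not_or,
      not_false_eq_true, List.nodup_nil, and_true] at hn
    obtain ⟨⟨hab, hac, had, hae⟩, ⟨hbc, hbd, hbe⟩, ⟨hcd, hce⟩, hde⟩ := hn
    have pos := @det_pos_of_not_holds p hp
    have key := pluecker (p a) (p b) (p c) (p d) (p e)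
    have k1 : 0 < det (p a) (p b) (p c) * det (p a) (p d) (p e) :=
      mul_pos (pos ha hb hc hab hac hbc h1) (pos ha hd he had hae hde h2)
    have k2 : 0 < det (p a) (p d) (p b) * det (p a) (p c) (p e) := by
      cases s
      · exact mul_pos (pos ha hd hb had hab (Ne.symm hbd) h3) (pos ha hc he hac hae hce h4)
      · rw [det_swap _ (p b), det_swap _ (p e), neg_mul_neg]
        exact mul_pos (pos ha hb hd hab had hbd h3) (pos ha he hc hae hac (Ne.symm hce) h4)
    have k3 : 0 < det (p a) (p b) (p e) * det (p a) (p c) (p d) := by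
      cases t
      · exact mul_pos (pos ha hb he hab hae hbe h5) (pos ha hc hd hac had hcd h6)
      · rw [det_swap _ (p e), det_swap _ (p d), neg_mul_neg]
        exact mul_pos (pos ha he hb hae hab (Ne.symm hbe) h5) (pos ha hd hc had hac (Ne.symm hcd) h6)
    linarith
  · simp [hn]

theorem exists_pentagonClause (hmem : ∀ i < 10, p i ∈ P)
    (hinj : ∀ i < 10, ∀ j < 10, p i = p j → i = j) (hsurj : ∀ x ∈ P, ∃ i < 10, p i = x)
    (hp : ∀ i < 10, ∀ j < 10, ∀ k < 10, i ≠ j → i ≠ k → j ≠ k → det (p i) (p j) (p k) ≠ 0)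
    (hno : ¬ ∃ S, EmptyConvexPentagon P S)
    {a b c d e : ℕ} (ha : a < 10) (hb : b < 10) (hc : c < 10) (hd : d < 10) (he : e < 10) :
    ∃ C ∈ pentagonClause a b c d e, ∀ l ∈ C, Holds p l := by
  unfold pentagonClause
  by_cases hn : [a, b, c, d, e].Nodup
  · rw [if_pos hn]
    by_contra! hcon
    rw [List.forall_mem_append] at hcon
    obtain ⟨hconv, hx⟩ := hcon
    simp only [List.forall_mem_cons, List.mem_singleton, forall_eq, exists_eq_left] at hconv
    obtain ⟨h1, h2, h3, h4, h5, h6, h7, h8, h9, h10⟩ := hconv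
    have pos := @det_pos_of_not_holds p hp
    have hn' := hn
    simp only [List.nodup_cons, List.mem_cons, List.not_mem_nil, or_false, not_or,
      not_false_eq_true, List.nodup_nil, and_true] at hn
    obtain ⟨⟨hab, hac, had, hae⟩, ⟨hbc, hbd, hbe⟩, ⟨hcd, hce⟩, hde⟩ := hn
    have hlt : ∀ i ∈ [a, b, c, d, e], i < 10 := by simp [ha, hb, hc, hd, he]
    refine hno ⟨{p a, p b, p c, p d, p e}, emptyConvexPentagon_of_det_pos (hmem a ha) (hmem b hb)
      (hmem c hc) (hmem d hd) (hmem e he) ?_ (pos ha hb hc hab hac hbc h1)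
      (pos ha hb hd hab had hbd h2) (pos ha hb he hab hae hbe h3)
      (pos ha hc hd hac had hcd h4) (pos ha hc he hac hae hce h5)
      (pos ha hd he had hae hde h6) (pos hb hc hd hbc hbd hcd h7)
      (pos hb hc he hbc hbe hce h8) (pos hb hd he hbd hbe hde h9)
      (pos hc hd he hcd hce hde h10) ?_⟩
    · have : ({p a, p b, p c, p d, p e} : Finset Pt) = [p a, p b, p c, p d, p e].toFinset := by
        simp
      rw [this, List.toFinset_card_of_nodup]
      · rfl
      · exact List.Nodup.map_on (l := [a, b, c, d, e])
          (fun i hi j hj => hinj i (hlt i hi) j (hlt j hj)) hn'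
    · intro y hy hyS
      obtain ⟨x, hx10, rfl⟩ := hsurj y hy
      have hxS : x ∉ [a, b, c, d, e] := by
        intro hmem
        apply hyS
        simp only [List.mem_cons, List.not_mem_nil, or_false] at hmem
        rcases hmem with rfl | rfl | rfl | rfl | rfl <;> simp
      obtain ⟨l, hl, hlx⟩ := hx _ (List.mem_map_of_mem (List.mem_filter.2
        ⟨List.mem_range.2 hx10, decide_eq_true hxS⟩))
      have hneg {i j : ℕ} (hi : i < 10) (hj : j < 10) (hij : i ≠ j) (hix : x ≠ i)
          (hjx : x ≠ j) (h : ¬ Holds p (lit i j x)) : det (p i) (p j) (p x) < 0 := by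
        rw [holds_lit p hi hj hx10, not_lt] at h
        exact lt_of_le_of_ne h (hp i hi j hj x hx10 hij hix.symm hjx.symm)
      simp only [List.mem_cons, List.not_mem_nil, or_false, not_or] at hl hxS
      obtain ⟨hxa, hxb, hxc, hxd, hxe⟩ := hxS
      rcases hl with rfl | rfl | rfl | rfl | rfl
      · exact Or.inl (hneg ha hb hab hxa hxb hlx)
      · exact Or.inr (Or.inl (hneg hb hc hbc hxb hxc hlx))
      · exact Or.inr (Or.inr (Or.inl (hneg hc hd hcd hxc hxd hlx)))
      · exact Or.inr (Or.inr (Or.inr (Or.inl (hneg hd he hde hxd hxe hlx))))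
      · exact Or.inr (Or.inr (Or.inr (Or.inr (hneg he ha (Ne.symm hae) hxe hxa hlx))))
  · simp [hn]

/-! ### Sorting the points by angle -/

theorem cross_nonneg_trans {u v w : Pt} (hu : 0 < u.1 ∨ u.1 = 0 ∧ 0 < u.2)
    (hv : 0 < v.1 ∨ v.1 = 0 ∧ 0 < v.2) (hw : 0 < w.1 ∨ w.1 = 0 ∧ 0 < w.2)
    (huv : 0 ≤ u.1 * v.2 - u.2 * v.1) (hvw : 0 ≤ v.1 * w.2 - v.2 * w.1) :
    0 ≤ u.1 * w.2 - u.2 * w.1 := by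
  have hu1 : 0 ≤ u.1 := by rcases hu with h | h <;> linarith
  have hw1 : 0 ≤ w.1 := by rcases hw with h | h <;> linarith
  rcases hv with hv | ⟨hv1, hv2⟩
  · refine nonneg_of_mul_nonneg_right (a := v.1) ?_ hv
    have : v.1 * (u.1 * w.2 - u.2 * w.1) =
        u.1 * (v.1 * w.2 - v.2 * w.1) + w.1 * (u.1 * v.2 - u.2 * v.1) := by ring
    rw [this]
    positivity
  · have hw0 : w.1 = 0 := by
      refine le_antisymm (nonpos_of_mul_nonpos_right (a := v.2) ?_ hv2) hw1
      rw [hv1] at hvw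
      linarith
    have hw2 : 0 < w.2 := by
      rcases hw with h | h
      · linarith
      · exact h.2
    rw [hw0, mul_zero, sub_zero]
    positivity

theorem exists_sorted (hcard : P.card = 10) (hgp : GenPos P) :
    ∃ p : ℕ → Pt, (∀ i < 10, p i ∈ P) ∧ (∀ i < 10, ∀ j < 10, p i = p j → i = j) ∧
      (∀ x ∈ P, ∃ i < 10, p i = x) ∧
      ∀ j k, 0 < j → j < k → k < 10 → 0 < det (p 0) (p j) (p k) := by
  obtain ⟨o, ho, hmin⟩ := P.exists_min_image toLex (Finset.card_pos.1 (by lia))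
  have hlex (q : P.erase o) :
      0 < (q.1 - o).1 ∨ (q.1 - o).1 = 0 ∧ 0 < (q.1 - o).2 := by
    have h := (hmin q (Finset.mem_of_mem_erase q.2)).lt_of_ne
      fun h => Finset.ne_of_mem_erase q.2 (toLex.injective h).symm
    rw [Prod.Lex.toLex_lt_toLex] at h
    simpa [sub_eq_zero, eq_comm] using h
  let le (q r : P.erase o) : Bool := decide (0 ≤ det o q r)
  let l := (P.erase o).attach.toList.mergeSort le
  have hperm : l.Perm (P.erase o).attach.toList := List.mergeSort_perm _ _
  have hl : l.Pairwise fun q r : P.erase o => 0 < det o q r := by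
    have hle : l.Pairwise fun q r => le q r := by
      refine List.pairwise_mergeSort (fun q r s hqr hrs => ?_) (fun q r => ?_) _
      · simp only [le, decide_eq_true_eq] at *
        exact cross_nonneg_trans (hlex q) (hlex r) (hlex s) hqr hrs
      · simp only [le, Bool.or_eq_true, decide_eq_true_eq]
        rw [det_swap o r.1 q.1, neg_nonneg]
        exact le_total _ _
    have hnodup : l.Nodup := hperm.nodup_iff.2 (Finset.nodup_toList _)
    refine (hle.and hnodup).imp fun {q r} h => lt_of_le_of_ne (of_decide_eq_true h.1) (Ne.symm ?_)
    exact det_ne_zero hgp ho (Finset.mem_of_mem_erase q.2) (Finset.mem_of_mem_erase r.2)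
      (Finset.ne_of_mem_erase q.2).symm (Finset.ne_of_mem_erase r.2).symm
      fun hqr => h.2 (Subtype.ext hqr)
  let m := o :: l.map Subtype.val
  have hmem (x : Pt) : x ∈ m ↔ x ∈ P := by
    simp only [m, List.mem_cons, List.mem_map, hperm.mem_iff, Finset.mem_toList,
      Finset.mem_attach, true_and, Subtype.exists, exists_prop, exists_eq_right, Finset.mem_erase]
    by_cases hx : x = o <;> simp [hx, ho]
  have hlen : m.length = 10 := by
    simp [m, hperm.length_eq, ho, hcard]
  have hnodup : m.Nodup := by
    refine List.nodup_cons.2 ⟨?_, (hperm.nodup_iff.2 (Finset.nodup_toList _)).map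
      Subtype.val_injective⟩
    rintro h
    obtain ⟨q, -, hq⟩ := List.mem_map.1 h
    exact Finset.ne_of_mem_erase q.2 hq
  have hget (i : ℕ) (hi : i < 10) : m.getD i o = m[i] := List.getD_eq_getElem _ _ _
  refine ⟨fun i => m.getD i o, fun i hi => ?_, fun i hi j hj h => ?_, fun x hx => ?_,
    fun j k hj hjk hk => ?_⟩
  · rw [← hmem]
    simp only [hget i hi]
    exact List.getElem_mem _
  · simp only [hget i hi, hget j hj] at h
    exact (hnodup.getElem_inj_iff).1 h
  · obtain ⟨i, hi, rfl⟩ := List.mem_iff_getElem.1 ((hmem x).2 hx)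
    exact ⟨i, hlen ▸ hi, hget i (hlen ▸ hi)⟩
  · obtain ⟨j, rfl⟩ := Nat.exists_eq_succ_of_ne_zero hj.ne'
    obtain ⟨k, rfl⟩ := Nat.exists_eq_succ_of_ne_zero (hj.trans hjk).ne'
    simp only [hget 0 (by lia), hget _ (hjk.trans hk), hget _ hk]
    simp only [m, List.getElem_cons_zero, List.getElem_cons_succ, List.getElem_map]
    exact List.pairwise_iff_getElem.1 hl _ _ _ _ (Nat.lt_of_succ_lt_succ hjk)

theorem exists_clause (hmem : ∀ i < 10, p i ∈ P)
    (hinj : ∀ i < 10, ∀ j < 10, p i = p j → i = j) (hsurj : ∀ x ∈ P, ∃ i < 10, p i = x)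
    (hgp : GenPos P) (hno : ¬ ∃ S, EmptyConvexPentagon P S) (n : ℕ) :
    ∃ c ∈ clause n, ∀ l ∈ c, Holds p l := by
  have hp : ∀ i < 10, ∀ j < 10, ∀ k < 10, i ≠ j → i ≠ k → j ≠ k → det (p i) (p j) (p k) ≠ 0 := by
    intro i hi j hj k hk hij hik hjk
    exact det_ne_zero hgp (hmem i hi) (hmem j hj) (hmem k hk) (fun e => hij (hinj i hi j hj e))
      (fun e => hik (hinj i hi k hk e)) fun e => hjk (hinj j hj k hk e)
  have digit (m : ℕ) : m % 10 < 10 := m.mod_lt (by decide)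
  unfold clause
  split_ifs
  · exact exists_orientClause hp (digit _) (digit _) (digit _)
  · exact exists_pentagonClause hmem hinj hsurj hp hno (digit _) (digit _) (digit _) (digit _)
      (digit _)
  · exact exists_plueckerClause hp (digit _) (digit _) (digit _) (digit _) (digit _) _ _

theorem models_sortedTriples
    (hsort : ∀ j k, 0 < j → j < k → k < 10 → 0 < det (p 0) (p j) (p k)) :
    Models p sortedTriples := by
  refine Models.extend (fun n hn => by simp at hn) fun l hl => ?_
  simp only [List.mem_flatMap, List.mem_map, List.mem_filter, List.mem_range,
    decide_eq_true_eq] at hl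
  obtain ⟨k, hk, j, ⟨hjk, hj⟩, rfl⟩ := hl
  exact (holds_lit p (by decide) (hjk.trans hk) hk).2 (hsort j k hj hjk hk)

end EmptyPentagon


/-- Harborth: every 10-point set in general position contains an empty convex pentagon. -/
theorem stmt16 (P : Finset Pt) (hcard : P.card = 10) (hgp : GenPos P) :
    ∃ S, EmptyConvexPentagon P S := by
  obtain ⟨p, hmem, hinj, hsurj, hsort⟩ := EmptyPentagon.exists_sorted hcard hgp
  by_contra hno
  exact EmptyPentagon.not_models_of_refute
    (EmptyPentagon.exists_clause hmem hinj hsurj hgp hno) EmptyPentagon.refute_certificate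
    List.mem_cons_self (EmptyPentagon.models_sortedTriples hsort)
end
end

section
/- Let ABCD be a parallelogram (4 points in convex position with AB parallel to DC and AD parallel to BC), and let E be a point in the interior of ABCD with all 5 points in general position. Then there exists a point F in the interior of ABCD such that the 6-point set {A,B,C,D,E,F} is in general position, has convex layer type (4,2), and contains no 5 points in convex position. -/
open scoped Classical
noncomputable section

/-- A parallelogram: four points in convex position with AB parallel to DC
(and hence AD parallel to BC). -/
def Parallelogram (a b c d : Pt) : Prop :=
  ConvexPos ({a, b, c, d} : Finset Pt) ∧ ({a, b, c, d} : Finset Pt).card = 4 ∧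
    b - a = c - d

/-- Collinear triples have proportional coordinate differences in any pair of linear coordinates. -/
lemma Collinear.linearMap_cross_eq {p q r : Pt} (h : Collinear ℝ ({p, q, r} : Set Pt))
    (X Y : Pt →ₗ[ℝ] ℝ) : (X q - X p) * (Y r - Y p) = (Y q - Y p) * (X r - X p) := by
  obtain ⟨v, hv⟩ := (collinear_iff_of_mem (p₀ := p) (by simp)).1 h
  obtain ⟨s, hs⟩ := hv q (by simp)
  obtain ⟨t, ht⟩ := hv r (by simp)
  simp only [vadd_eq_add] at hs ht
  rw [hs, ht]
  simp only [map_add, map_smul, smul_eq_mul]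
  ring

lemma collinear_of_eq_add_smul {p q r : Pt} (t : ℝ) (h : r = p + t • (q - p)) :
    Collinear ℝ ({p, q, r} : Set Pt) := by
  refine (collinear_iff_of_mem (p₀ := p) (by simp)).2 ⟨q - p, ?_⟩
  simp only [Set.mem_insert_iff, Set.mem_singleton_iff, vadd_eq_add]
  rintro x (rfl | rfl | rfl)
  · exact ⟨0, by simp⟩
  · exact ⟨1, by simp⟩
  · exact ⟨t, by rw [h, add_comm]⟩

lemma collinear_of_det_eq_zero {p q r : Pt} (hpq : p ≠ q) (h : det p q r = 0) :
    Collinear ℝ ({p, q, r} : Set Pt) := by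
  unfold det at h
  by_cases h1 : q.1 - p.1 = 0
  · have h2 : q.2 - p.2 ≠ 0 := fun h2 => hpq (Prod.ext (by linarith) (by linarith))
    refine collinear_of_eq_add_smul ((r.2 - p.2) / (q.2 - p.2)) (Prod.ext ?_ ?_)
    · simp only [Prod.fst_add, Prod.smul_fst, Prod.fst_sub, smul_eq_mul]
      field_simp
      linarith
    · simp only [Prod.snd_add, Prod.smul_snd, Prod.snd_sub, smul_eq_mul]
      field_simp
      ring
  · refine collinear_of_eq_add_smul ((r.1 - p.1) / (q.1 - p.1)) (Prod.ext ?_ ?_)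
    · simp only [Prod.fst_add, Prod.smul_fst, Prod.fst_sub, smul_eq_mul]
      field_simp
      ring
    · simp only [Prod.snd_add, Prod.smul_snd, Prod.snd_sub, smul_eq_mul]
      field_simp
      linarith

lemma GenPos.insert {S : Finset Pt} {p : Pt} (hS : GenPos S)
    (h : ∀ q ∈ S, ∀ r ∈ S, q ≠ r → ¬ Collinear ℝ ({p, q, r} : Set Pt)) :
    GenPos (insert p S) := by
  intro a ha b hb c hc hab hac hbc hcol
  rw [Finset.mem_insert] at ha hb hc
  rcases ha with rfl | ha
  · exact h b (hb.resolve_left hab.symm) c (hc.resolve_left hac.symm) hbc hcol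
  rcases hb with rfl | hb
  · exact h a ha c (hc.resolve_left hbc.symm) hac (by rwa [Set.insert_comm])
  rcases hc with rfl | hc
  · refine h a ha b hb hab ?_
    rwa [Set.insert_comm, Set.pair_comm c b]
  · exact hS a ha b hb c hc hab hac hbc hcol

lemma mem_convexHull_triple {p q r x : Pt} {a b c : ℝ} (ha : 0 ≤ a) (hb : 0 ≤ b) (hc : 0 ≤ c)
    (h : a + b + c = 1) (hx : x = a • p + b • q + c • r) :
    x ∈ convexHull ℝ ({p, q, r} : Set Pt) := by
  have := (convex_convexHull ℝ ({p, q, r} : Set Pt)).sum_mem (t := Finset.univ)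
    (w := ![a, b, c]) (z := ![p, q, r])
    (by intro i _; fin_cases i <;> simpa) (by simpa [Fin.sum_univ_three] using h)
    (by intro i _; apply subset_convexHull; fin_cases i <;> simp)
  rw [hx]
  simpa [Fin.sum_univ_three] using this

lemma not_mem_convexHull_of_lt {S : Set Pt} {p : Pt} (f : Pt →ₗ[ℝ] ℝ)
    (h : ∀ q ∈ S, f p < f q) : p ∉ convexHull ℝ S := fun hp =>
  lt_irrefl (f p) (convexHull_min (t := {q | f p < f q}) h
    (convex_halfSpace_gt f.isLinear (f p)) hp)

lemma not_mem_convexHull_erase_of_lt {S : Finset Pt} {p : Pt} (f : Pt →ₗ[ℝ] ℝ)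
    (h : ∀ q ∈ S, q ≠ p → f p < f q) :
    p ∉ convexHull ℝ ((S.erase p : Finset Pt) : Set Pt) :=
  not_mem_convexHull_of_lt f fun q hq =>
    h q (Finset.mem_of_mem_erase hq) (Finset.ne_of_mem_erase hq)

lemma exists_pos_add_smul_mem {S : Set Pt} {p : Pt} (hp : p ∈ interior S) (v : Pt) :
    ∃ t : ℝ, 0 < t ∧ p + t • v ∈ S := by
  have hc : Filter.Tendsto (fun t : ℝ => p + t • v) (nhdsWithin 0 (Set.Ioi 0)) (nhds p) := by
    have : Continuous fun t : ℝ => p + t • v := by fun_prop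
    simpa using (this.tendsto 0).mono_left nhdsWithin_le_nhds
  have h1 := hc.eventually (mem_interior_iff_mem_nhds.1 hp)
  obtain ⟨t, ht, ht'⟩ := (h1.and self_mem_nhdsWithin).exists
  exact ⟨t, ht', ht⟩

lemma exists_dual_coordinates {u v : Pt} (h : u.1 * v.2 - u.2 * v.1 ≠ 0) :
    ∃ X Y : Pt →ₗ[ℝ] ℝ, X u = 1 ∧ X v = 0 ∧ Y u = 0 ∧ Y v = 1 := by
  refine ⟨(u.1 * v.2 - u.2 * v.1)⁻¹ • (v.2 • LinearMap.fst ℝ ℝ ℝ - v.1 • LinearMap.snd ℝ ℝ ℝ),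
    (u.1 * v.2 - u.2 * v.1)⁻¹ • (u.1 • LinearMap.snd ℝ ℝ ℝ - u.2 • LinearMap.fst ℝ ℝ ℝ), ?_, ?_, ?_, ?_⟩ <;>
    simp only [LinearMap.smul_apply, LinearMap.sub_apply, LinearMap.fst_apply,
      LinearMap.snd_apply, smul_eq_mul]
  · rw [inv_mul_eq_one₀ h]; ring
  · ring
  · ring
  · rw [inv_mul_eq_one₀ h]

/-- The parallelogram with one interior point `E` extends by an interior point to a set of
layer type (4,2) without convex pentagons. -/
def HasPentagonFreeExtension (A B C D E : Pt) : Prop :=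
  ∃ F : Pt, F ∈ interior (convexHull ℝ ({A, B, C, D} : Set Pt)) ∧
    ({A, B, C, D, E, F} : Finset Pt).card = 6 ∧
    GenPos ({A, B, C, D, E, F} : Finset Pt) ∧
    hullVerts ({A, B, C, D, E, F} : Finset Pt) = ({A, B, C, D} : Finset Pt) ∧
    ¬ ∃ S ⊆ ({A, B, C, D, E, F} : Finset Pt), S.card = 5 ∧ ConvexPos S

lemma HasPentagonFreeExtension.rotate {A B C D E : Pt}
    (h : HasPentagonFreeExtension B C D A E) : HasPentagonFreeExtension A B C D E := by
  obtain ⟨F, h⟩ := h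
  have h1 : ({B, C, D, A} : Set Pt) = {A, B, C, D} := by
    ext; simp only [Set.mem_insert_iff, Set.mem_singleton_iff]; tauto
  have h2 : ({B, C, D, A} : Finset Pt) = {A, B, C, D} := by
    ext; simp only [Finset.mem_insert, Finset.mem_singleton]; tauto
  have h3 : ({B, C, D, A, E, F} : Finset Pt) = {A, B, C, D, E, F} := by
    ext; simp only [Finset.mem_insert, Finset.mem_singleton]; tauto
  rw [h1, h2, h3] at h
  exact ⟨F, h⟩

lemma genPos_rotate {A B C D E : Pt} (h : GenPos ({A, B, C, D, E} : Finset Pt)) :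
    GenPos ({B, C, D, A, E} : Finset Pt) := by
  have h3 : ({B, C, D, A, E} : Finset Pt) = {A, B, C, D, E} := by
    ext; simp only [Finset.mem_insert, Finset.mem_singleton]; tauto
  rwa [h3]

lemma interior_hull_rotate {A B C D E : Pt}
    (h : E ∈ interior (convexHull ℝ ({A, B, C, D} : Set Pt))) :
    E ∈ interior (convexHull ℝ ({B, C, D, A} : Set Pt)) := by
  have h1 : ({B, C, D, A} : Set Pt) = {A, B, C, D} := by
    ext; simp only [Set.mem_insert_iff, Set.mem_singleton_iff]; tauto
  rwa [h1]

lemma not_convexPos_of_mem_convexHull {S : Finset Pt} {q : Pt} {T : Set Pt} (hq : q ∈ S)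
    (hT : ∀ x ∈ T, x ∈ S ∧ x ≠ q) (h : q ∈ convexHull ℝ T) : ¬ ConvexPos S := fun hS =>
  hS q hq (convexHull_mono (fun x hx => by
    rw [Finset.mem_coe, Finset.mem_erase]; exact (hT x hx).symm) h)

lemma card_eq_six_of_nodup {A B C D E F : Pt} (h : [A, B, C, D, E, F].Nodup) :
    ({A, B, C, D, E, F} : Finset Pt).card = 6 := by
  simpa using List.toFinset_card_of_nodup h

lemma not_exists_convexPos_five {A B C D E F : Pt} (hne : [A, B, C, D, E, F].Nodup)
    (hFBCD : F ∈ convexHull ℝ ({B, C, D} : Set Pt))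
    (hFACD : F ∈ convexHull ℝ ({A, C, D} : Set Pt))
    (hEABD : E ∈ convexHull ℝ ({A, B, D} : Set Pt))
    (hEABC : E ∈ convexHull ℝ ({A, B, C} : Set Pt)) :
    ¬ ∃ S ⊆ ({A, B, C, D, E, F} : Finset Pt), S.card = 5 ∧ ConvexPos S := by
  rintro ⟨S, hS, hcard, hconv⟩
  obtain ⟨p, hp⟩ : ∃ p, ({A, B, C, D, E, F} : Finset Pt) \ S = {p} := by
    rw [← Finset.card_eq_one, Finset.card_sdiff_of_subset hS, card_eq_six_of_nodup hne, hcard]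
  have hpm : p ∈ ({A, B, C, D, E, F} : Finset Pt) :=
    (Finset.mem_sdiff.1 (hp ▸ Finset.mem_singleton_self p)).1
  have hmem : ∀ q ∈ ({A, B, C, D, E, F} : Finset Pt), q ≠ p → q ∈ S := by
    intro q hq hqp
    by_contra hqS
    exact hqp (Finset.mem_singleton.1 (hp ▸ Finset.mem_sdiff.2 ⟨hq, hqS⟩))
  have triple : ∀ {q a b c : Pt}, q ∈ convexHull ℝ ({a, b, c} : Set Pt) →
      (q ∈ S ∧ a ∈ S ∧ b ∈ S ∧ c ∈ S) → a ≠ q → b ≠ q → c ≠ q → False := by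
    rintro q a b c h ⟨hq, ha, hb, hc⟩ haq hbq hcq
    refine not_convexPos_of_mem_convexHull hq ?_ h hconv
    rintro x (rfl | rfl | rfl)
    exacts [⟨ha, haq⟩, ⟨hb, hbq⟩, ⟨hc, hcq⟩]
  simp only [List.nodup_cons, List.mem_cons, List.not_mem_nil, or_false, not_or] at hne
  obtain ⟨⟨hAB, hAC, hAD, hAE, hAF⟩, ⟨hBC, hBD, hBE, hBF⟩, ⟨hCD, hCE, hCF⟩, ⟨hDE, hDF⟩,
    hEF, -⟩ := hne
  simp only [Finset.mem_insert, Finset.mem_singleton, forall_eq_or_imp, forall_eq] at hpm hmem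
  obtain ⟨mA, mB, mC, mD, mE, mF⟩ := hmem
  rcases hpm with h | h | h | h | h | h <;> rw [h] at mA mB mC mD mE mF
  · exact triple hFBCD ⟨mF (Ne.symm hAF), mB (Ne.symm hAB), mC (Ne.symm hAC), mD (Ne.symm hAD)⟩
      hBF hCF hDF
  · exact triple hFACD ⟨mF (Ne.symm hBF), mA hAB, mC (Ne.symm hBC), mD (Ne.symm hBD)⟩
      hAF hCF hDF
  · exact triple hEABD ⟨mE (Ne.symm hCE), mA hAC, mB hBC, mD (Ne.symm hCD)⟩ hAE hBE hDE
  · exact triple hEABC ⟨mE (Ne.symm hDE), mA hAD, mB hBD, mC hCD⟩ hAE hBE hCE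
  · exact triple hFBCD ⟨mF (Ne.symm hEF), mB hBE, mC hCE, mD hDE⟩ hBF hCF hDF
  · exact triple hEABD ⟨mE hEF, mA hAF, mB hBF, mD hDF⟩ hAE hBE hDE

lemma hullVerts_eq_of_mem_convexHull {A B C D E F : Pt} (hne : [A, B, C, D, E, F].Nodup)
    (hA : A ∉ convexHull ℝ ((({A, B, C, D, E, F} : Finset Pt).erase A : Finset Pt) : Set Pt))
    (hB : B ∉ convexHull ℝ ((({A, B, C, D, E, F} : Finset Pt).erase B : Finset Pt) : Set Pt))
    (hC : C ∉ convexHull ℝ ((({A, B, C, D, E, F} : Finset Pt).erase C : Finset Pt) : Set Pt))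
    (hD : D ∉ convexHull ℝ ((({A, B, C, D, E, F} : Finset Pt).erase D : Finset Pt) : Set Pt))
    (hE : E ∈ convexHull ℝ ({A, B, C, D} : Set Pt))
    (hF : F ∈ convexHull ℝ ({A, B, C, D} : Set Pt)) :
    hullVerts ({A, B, C, D, E, F} : Finset Pt) = ({A, B, C, D} : Finset Pt) := by
  simp only [List.nodup_cons, List.mem_cons, List.not_mem_nil, or_false, not_or] at hne
  obtain ⟨⟨hAB, hAC, hAD, hAE, hAF⟩, ⟨hBC, hBD, hBE, hBF⟩, ⟨hCD, hCE, hCF⟩, ⟨hDE, hDF⟩,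
    hEF, -⟩ := hne
  have hE' := convexHull_mono (t := ((({A, B, C, D, E, F} : Finset Pt).erase E : Finset Pt) :
    Set Pt)) (by simp [Set.insert_subset_iff, hAE, hBE, hCE, hDE]) hE
  have hF' := convexHull_mono (t := ((({A, B, C, D, E, F} : Finset Pt).erase F : Finset Pt) :
    Set Pt)) (by simp [Set.insert_subset_iff, hAF, hBF, hCF, hDF]) hF
  ext p
  rw [hullVerts, Finset.mem_filter]
  constructor
  · rintro ⟨hp, hp'⟩
    simp only [Finset.mem_insert, Finset.mem_singleton] at hp ⊢
    rcases hp with h | h | h | h | rfl | rfl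
    · exact .inl h
    · exact .inr (.inl h)
    · exact .inr (.inr (.inl h))
    · exact .inr (.inr (.inr h))
    · exact absurd hE' hp'
    · exact absurd hF' hp'
  · intro hp
    simp only [Finset.mem_insert, Finset.mem_singleton] at hp
    rcases hp with rfl | rfl | rfl | rfl
    · exact ⟨by simp, hA⟩
    · exact ⟨by simp, hB⟩
    · exact ⟨by simp, hC⟩
    · exact ⟨by simp, hD⟩

/-- If `E` lies in the triangle cut off by the diagonals at the side `AB`, its mirror image along
the direction `AD` is a suitable new point. -/
lemma hasPentagonFreeExtension_of_lt {A B C D E : Pt} {x y : ℝ} (hd : det A B D ≠ 0)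
    (hC : C = B + D - A) (hE : E = A + x • (B - A) + y • (D - A))
    (hint : E ∈ interior (convexHull ℝ ({A, B, C, D} : Set Pt)))
    (hgp : GenPos ({A, B, C, D, E} : Finset Pt))
    (hy : 0 < y) (hyx : y < x) (hxy : x + y < 1) : HasPentagonFreeExtension A B C D E := by
  obtain ⟨X, Y, hXu, hXv, hYu, hYv⟩ := exists_dual_coordinates (u := B - A) (v := D - A)
    (by simpa [det] using hd)
  obtain ⟨F, hF⟩ : ∃ F : Pt, F = A + x • (B - A) + (1 - y) • (D - A) := ⟨_, rfl⟩
  have hXC : X C = X A + 1 := by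
    rw [hC]; simp only [map_add, map_sub] at *; linarith
  have hYC : Y C = Y A + 1 := by
    rw [hC]; simp only [map_add, map_sub] at *; linarith
  have hXE : X E = X A + x := by
    rw [hE, map_add, map_add, map_smul, map_smul, hXu, hXv]; simp
  have hYE : Y E = Y A + y := by
    rw [hE, map_add, map_add, map_smul, map_smul, hYu, hYv]; simp
  have hXF : X F = X A + x := by
    rw [hF, map_add, map_add, map_smul, map_smul, hXu, hXv]; simp
  have hYF : Y F = Y A + (1 - y) := by
    rw [hF, map_add, map_add, map_smul, map_smul, hYu, hYv]; simp
  have hXB : X B = X A + 1 := by rw [map_sub] at hXu; linarith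
  have hYB : Y B = Y A := by rw [map_sub] at hYu; linarith
  have hXD : X D = X A := by rw [map_sub] at hXv; linarith
  have hYD : Y D = Y A + 1 := by rw [map_sub] at hYv; linarith
  clear hXu hXv hYu hYv
  have neX : ∀ {P Q : Pt}, X P ≠ X Q → P ≠ Q := fun h h' => h (by rw [h'])
  have neY : ∀ {P Q : Pt}, Y P ≠ Y Q → P ≠ Q := fun h h' => h (by rw [h'])
  have hAB : A ≠ B := neX (by intro h; linarith)
  have hAC : A ≠ C := neX (by intro h; linarith)
  have hAD : A ≠ D := neY (by intro h; linarith)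
  have hAE : A ≠ E := neX (by intro h; linarith)
  have hAF : A ≠ F := neX (by intro h; linarith)
  have hBC : B ≠ C := neY (by intro h; linarith)
  have hBD : B ≠ D := neY (by intro h; linarith)
  have hBE : B ≠ E := neX (by intro h; linarith)
  have hBF : B ≠ F := neX (by intro h; linarith)
  have hCD : C ≠ D := neX (by intro h; linarith)
  have hCE : C ≠ E := neX (by intro h; linarith)
  have hCF : C ≠ F := neX (by intro h; linarith)
  have hDE : D ≠ E := neX (by intro h; linarith)
  have hDF : D ≠ F := neX (by intro h; linarith)
  have hEF : E ≠ F := neY (by intro h; linarith)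
  have hFBCD : F ∈ convexHull ℝ ({B, C, D} : Set Pt) := by
    refine mem_convexHull_triple (a := y) (b := x - y) (c := 1 - x) (by linarith) (by linarith)
      (by linarith) (by ring) ?_
    rw [hF, hC]; module
  have hFACD : F ∈ convexHull ℝ ({A, C, D} : Set Pt) := by
    refine mem_convexHull_triple (a := y) (b := x) (c := 1 - x - y) (by linarith) (by linarith)
      (by linarith) (by ring) ?_
    rw [hF, hC]; module
  have hEABD : E ∈ convexHull ℝ ({A, B, D} : Set Pt) := by
    refine mem_convexHull_triple (a := 1 - x - y) (b := x) (c := y) (by linarith) (by linarith)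
      (by linarith) (by ring) ?_
    rw [hE]; module
  have hEABC : E ∈ convexHull ℝ ({A, B, C} : Set Pt) := by
    refine mem_convexHull_triple (a := 1 - x) (b := x - y) (c := y) (by linarith) (by linarith)
      (by linarith) (by ring) ?_
    rw [hE, hC]; module
  have hFint : F ∈ interior (convexHull ℝ ({A, B, C, D} : Set Pt)) := by
    have hG : x • C + (1 - x) • D ∈ convexHull ℝ ({A, B, C, D} : Set Pt) :=
      convex_convexHull ℝ _ (subset_convexHull ℝ _ (by simp)) (subset_convexHull ℝ _ (by simp))
        (by linarith) (by linarith) (by ring)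
    refine (convex_convexHull ℝ _).openSegment_interior_self_subset_interior hint hG
      ⟨y / (1 - y), (1 - 2 * y) / (1 - y), div_pos hy (by linarith),
        div_pos (by linarith) (by linarith), ?_, ?_⟩
    · rw [← add_div, div_eq_one_iff_eq (by linarith)]; ring
    · have h1 : 1 - y ≠ 0 := by linarith
      rw [hF, hE, hC]
      ext <;> simp <;> field_simp <;> ring
  have hne : [A, B, C, D, E, F].Nodup := by
    simp only [List.nodup_cons, List.mem_cons, List.not_mem_nil, or_false, not_or]
    exact ⟨⟨hAB, hAC, hAD, hAE, hAF⟩, ⟨hBC, hBD, hBE, hBF⟩, ⟨hCD, hCE, hCF⟩, ⟨hDE, hDF⟩,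
      hEF, by simp⟩
  clear hE hF hC
  refine ⟨F, hFint, card_eq_six_of_nodup hne, ?_, ?_,
    not_exists_convexPos_five hne hFBCD hFACD hEABD hEABC⟩
  · have hset : ({A, B, C, D, E, F} : Finset Pt) = insert F {A, B, C, D, E} := by
      ext; simp only [Finset.mem_insert, Finset.mem_singleton]; tauto
    rw [hset]
    refine hgp.insert fun q hq r hr hqr hcol => ?_
    have h := hcol.linearMap_cross_eq X Y
    simp only [Finset.mem_insert, Finset.mem_singleton] at hq hr
    have h2 : 0 < x * (1 - 2 * y) := mul_pos (by linarith) (by linarith)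
    have h3 : 0 < (1 - x) * (1 - 2 * y) := mul_pos (by linarith) (by linarith)
    rcases hq with rfl | rfl | rfl | rfl | rfl <;> rcases hr with rfl | rfl | rfl | rfl | rfl <;>
      first
      | exact hqr rfl
      | (simp only [hXB, hXC, hXD, hXE, hXF, hYB, hYC, hYD, hYE, hYF] at h
         ring_nf at h h2 h3
         linarith)
  · refine hullVerts_eq_of_mem_convexHull hne ?_ ?_ ?_ ?_ (interior_subset hint)
      (interior_subset hFint)
    · refine not_mem_convexHull_erase_of_lt (X + Y) ?_
      simp only [Finset.mem_insert, Finset.mem_singleton, forall_eq_or_imp, forall_eq,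
        LinearMap.add_apply]
      refine ⟨?_, ?_, ?_, ?_, ?_, ?_⟩ <;> intro h <;>
        first
        | exact absurd rfl h
        | linarith
    · refine not_mem_convexHull_erase_of_lt (Y - X) ?_
      simp only [Finset.mem_insert, Finset.mem_singleton, forall_eq_or_imp, forall_eq,
        LinearMap.sub_apply]
      refine ⟨?_, ?_, ?_, ?_, ?_, ?_⟩ <;> intro h <;>
        first
        | exact absurd rfl h
        | linarith
    · refine not_mem_convexHull_erase_of_lt (-X - Y) ?_
      simp only [Finset.mem_insert, Finset.mem_singleton, forall_eq_or_imp, forall_eq,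
        LinearMap.sub_apply, LinearMap.neg_apply]
      refine ⟨?_, ?_, ?_, ?_, ?_, ?_⟩ <;> intro h <;>
        first
        | exact absurd rfl h
        | linarith
    · refine not_mem_convexHull_erase_of_lt (X - Y) ?_
      simp only [Finset.mem_insert, Finset.mem_singleton, forall_eq_or_imp, forall_eq,
        LinearMap.sub_apply]
      refine ⟨?_, ?_, ?_, ?_, ?_, ?_⟩ <;> intro h <;>
        first
        | exact absurd rfl h
        | linarith

lemma exists_coordinates_of_mem_convexHull {A B C D P : Pt} (hC : C = B + D - A)
    (hP : P ∈ convexHull ℝ ({A, B, C, D} : Set Pt)) :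
    ∃ x y : ℝ, 0 ≤ x ∧ x ≤ 1 ∧ 0 ≤ y ∧ y ≤ 1 ∧ P = A + x • (B - A) + y • (D - A) := by
  refine convexHull_min (t := {P | ∃ x y : ℝ, 0 ≤ x ∧ x ≤ 1 ∧ 0 ≤ y ∧ y ≤ 1 ∧
    P = A + x • (B - A) + y • (D - A)}) ?_ ?_ hP
  · rintro q (rfl | rfl | rfl | rfl)
    · exact ⟨0, 0, by simp⟩
    · exact ⟨1, 0, by simp⟩
    · exact ⟨1, 1, by simp, by simp, by simp, by simp, by rw [hC]; module⟩
    · exact ⟨0, 1, by simp⟩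
  · rintro _ ⟨x, y, hx, hx', hy, hy', rfl⟩ _ ⟨z, w, hz, hz', hw, hw', rfl⟩ a b ha hb hab
    refine ⟨a * x + b * z, a * y + b * w, by positivity, ?_, by positivity, ?_, ?_⟩
    · nlinarith
    · nlinarith
    · obtain rfl : b = 1 - a := by linarith
      module

lemma exists_coordinates_of_mem_interior {A B C D E : Pt} (hd : det A B D ≠ 0)
    (hC : C = B + D - A) (hE : E ∈ interior (convexHull ℝ ({A, B, C, D} : Set Pt))) :
    ∃ x y : ℝ, 0 < x ∧ x < 1 ∧ 0 < y ∧ y < 1 ∧ E = A + x • (B - A) + y • (D - A) := by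
  obtain ⟨X, Y, hXu, hXv, hYu, hYv⟩ := exists_dual_coordinates (u := B - A) (v := D - A)
    (by simpa [det] using hd)
  obtain ⟨x, y, -, -, -, -, hxy⟩ := exists_coordinates_of_mem_convexHull hC (interior_subset hE)
  have key : ∀ v : Pt, ∃ t : ℝ, 0 < t ∧ 0 ≤ x + t * X v ∧ x + t * X v ≤ 1 ∧
      0 ≤ y + t * Y v ∧ y + t * Y v ≤ 1 := by
    intro v
    obtain ⟨t, ht, hm⟩ := exists_pos_add_smul_mem hE v
    obtain ⟨z, w, hz, hz', hw, hw', hzw⟩ := exists_coordinates_of_mem_convexHull hC hm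
    rw [hxy] at hzw
    have h1 := congrArg X hzw
    have h2 := congrArg Y hzw
    simp only [map_add, map_smul, hXu, hXv, hYu, hYv, smul_eq_mul] at h1 h2
    exact ⟨t, ht, by linarith, by linarith, by linarith, by linarith⟩
  obtain ⟨t, ht, h1, -, h2, -⟩ := key (-(B - A) - (D - A))
  obtain ⟨s, hs, -, h3, -, h4⟩ := key ((B - A) + (D - A))
  rw [map_sub, map_neg, hXu, hXv] at h1
  rw [map_sub, map_neg, hYu, hYv] at h2
  rw [map_add, hXu, hXv] at h3
  rw [map_add, hYu, hYv] at h4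
  exact ⟨x, y, by linarith, by linarith, by linarith, by linarith, hxy⟩

/-- Given a parallelogram with one interior point, a second interior point may be
added so that the 6-point set has layer type (4,2) and no 5 points in convex position. -/
theorem stmt17 (A B C D E : Pt) (hpar : Parallelogram A B C D)
    (hE : E ∈ interior (convexHull ℝ ({A, B, C, D} : Set Pt)))
    (hgp : GenPos ({A, B, C, D, E} : Finset Pt)) :
    ∃ F : Pt, F ∈ interior (convexHull ℝ ({A, B, C, D} : Set Pt)) ∧
      ({A, B, C, D, E, F} : Finset Pt).card = 6 ∧
      GenPos ({A, B, C, D, E, F} : Finset Pt) ∧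
      hullVerts ({A, B, C, D, E, F} : Finset Pt) = ({A, B, C, D} : Finset Pt) ∧
      ¬ ∃ S ⊆ ({A, B, C, D, E, F} : Finset Pt), S.card = 5 ∧ ConvexPos S := by
  obtain ⟨-, hcard, hC⟩ := hpar
  replace hC : C = B + D - A := by
    rw [sub_eq_sub_iff_add_eq_add] at hC
    exact eq_sub_of_add_eq hC.symm
  have hAB : A ≠ B := by
    rintro rfl
    have := Finset.card_le_three (a := A) (b := C) (c := D)
    simp only [Finset.insert_idem] at hcard
    omega
  have hAD : A ≠ D := by
    rintro rfl
    have := Finset.card_le_three (a := A) (b := B) (c := C)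
    rw [show ({A, B, C, A} : Finset Pt) = {A, B, C} by
      ext; simp only [Finset.mem_insert, Finset.mem_singleton]; tauto] at hcard
    omega
  have hBD : B ≠ D := by
    rintro rfl
    have := Finset.card_le_three (a := A) (b := B) (c := C)
    rw [show ({A, B, C, B} : Finset Pt) = {A, B, C} by
      ext; simp only [Finset.mem_insert, Finset.mem_singleton]; tauto] at hcard
    omega
  have hAC : A ≠ C := by
    rintro rfl
    have := Finset.card_le_three (a := A) (b := B) (c := D)
    rw [show ({A, B, A, D} : Finset Pt) = {A, B, D} by
      ext; simp only [Finset.mem_insert, Finset.mem_singleton]; tauto] at hcard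
    omega
  have hd : det A B D ≠ 0 := fun h =>
    hgp A (by simp) B (by simp) D (by simp) hAB hAD hBD (collinear_of_det_eq_zero hAB h)
  obtain ⟨x, y, hx, hx', hy, hy', hxy⟩ := exists_coordinates_of_mem_interior hd hC hE
  have dABE : det A B E = y * det A B D := by rw [hxy]; simp [det]; ring
  have dADE : det A D E = - x * det A B D := by rw [hxy]; simp [det]; ring
  have hAE : A ≠ E := by
    rintro rfl
    have : y * det A B D = 0 := by rw [← dABE]; simp [det]
    exact mul_ne_zero hy.ne' hd this
  have hCE : C ≠ E := by
    rintro rfl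
    have : (1 - y) * det A B D = 0 := by
      rw [sub_mul, ← dABE, hC]; simp [det]; ring
    exact mul_ne_zero (by linarith) hd this
  have hBE : B ≠ E := by
    rintro rfl
    have : y * det A B D = 0 := by rw [← dABE]; simp [det]; ring
    exact mul_ne_zero hy.ne' hd this
  have hDE : D ≠ E := by
    rintro rfl
    have : x * det A B D = 0 := by
      have : det A D D = 0 := by simp [det]; ring
      linarith
    exact mul_ne_zero hx.ne' hd this
  have h1 : y ≠ x := by
    rintro rfl
    refine hgp A (by simp) C (by simp) E (by simp) hAC hAE hCE
      (collinear_of_eq_add_smul y ?_)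
    rw [hxy, hC]; module
  have h2 : x + y ≠ 1 := by
    intro h
    refine hgp B (by simp) D (by simp) E (by simp) hBD hBE hDE
      (collinear_of_eq_add_smul y ?_)
    obtain rfl : x = 1 - y := by linarith
    rw [hxy]; module
  change HasPentagonFreeExtension A B C D E
  rcases lt_or_gt_of_ne h1 with h1 | h1 <;> rcases lt_or_gt_of_ne h2 with h2 | h2
  · exact hasPentagonFreeExtension_of_lt hd hC hxy hE hgp hy h1 h2
  · refine (hasPentagonFreeExtension_of_lt (x := y) (y := 1 - x) ?_ ?_ ?_
      (interior_hull_rotate hE) (genPos_rotate hgp) (by linarith) (by linarith)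
      (by linarith)).rotate
    · convert hd using 1; rw [hC]; simp [det]; ring
    · rw [hC]; module
    · rw [hxy, hC]; module
  · refine (hasPentagonFreeExtension_of_lt (x := 1 - y) (y := x) ?_ ?_ ?_
      (interior_hull_rotate (interior_hull_rotate (interior_hull_rotate hE)))
      (genPos_rotate (genPos_rotate (genPos_rotate hgp))) (by linarith) (by linarith)
      (by linarith)).rotate.rotate.rotate
    · convert hd using 1; rw [hC]; simp [det]; ring
    · rw [hC]; module
    · rw [hxy, hC]; module
  · refine (hasPentagonFreeExtension_of_lt (x := 1 - x) (y := 1 - y) ?_ ?_ ?_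
      (interior_hull_rotate (interior_hull_rotate hE))
      (genPos_rotate (genPos_rotate hgp)) (by linarith) (by linarith)
      (by linarith)).rotate.rotate
    · convert hd using 1; rw [hC]; simp [det]; ring
    · rw [hC]; module
    · rw [hxy, hC]; module
end
end
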